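/- Let X = ℝⁿ and 𝒫 = ℝˡ be finite-dimensional, (𝒬,d₂) a metric space, x̄ ∈ S(v̄,p̄,q̄), and assume (A1)–(A4). Then x̄ is a Lipschitzian fully stable solution corresponding to (v̄,p̄,q̄) if and only if both of the following pointbased conditions hold, where D*(∂_x g) denotes the limiting coderivative of the set-valued map (x,p) ↦ ∂_x g(x,p) from ℝⁿ × ℝˡ into ℝⁿ at (x̄,p̄,v̂): (a) (0,z) ∈ D*(∂_x g)(x̄,p̄,v̂)(0) implies z = 0; and (b) ⟨∇_x f(x̄,p̄,q̄)w, w⟩ + ⟨z, w⟩ > 0 for every w ≠ 0 and every (z,s) ∈ D*(∂_x g)(x̄,p̄,v̂)(w). -/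

import Mathlib

noncomputable section

open Filter Topology Metric Set MeasureTheory
open scoped RealInnerProductSpace Pointwise

namespace PVS

variable {X : Type*} [NormedAddCommGroup X] [InnerProductSpace ℝ X]
variable {Y : Type*} [NormedAddCommGroup Y] [InnerProductSpace ℝ Y]
variable {W : Type*} [NormedAddCommGroup W] [InnerProductSpace ℝ W]
variable {P : Type*} [MetricSpace P]
variable {Q : Type*} [MetricSpace Q]

/-- Regular (Fréchet) subdifferential of an extended-real-valued function. -/
def regSubdiff (h : X → EReal) (x : X) : Set X :=
  {v | h x ≠ ⊤ ∧ h x ≠ ⊥ ∧ ∀ ε > (0:ℝ), ∀ᶠ u in 𝓝 x,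
      h x + ((⟪v, u - x⟫ - ε * ‖u - x‖ : ℝ) : EReal) ≤ h u}

/-- Weak sequential convergence in an inner product space. -/
def WeakTendsto (xs : ℕ → X) (x : X) : Prop :=
  ∀ z : X, Tendsto (fun k => ⟪xs k, z⟫) atTop (𝓝 ⟪x, z⟫)

/-- Limiting (Mordukhovich) subdifferential. -/
def limSubdiff (h : X → EReal) (x : X) : Set X :=
  {v | ∃ xs vs : ℕ → X, Tendsto xs atTop (𝓝 x) ∧
      Tendsto (fun k => h (xs k)) atTop (𝓝 (h x)) ∧
      (∀ k, vs k ∈ regSubdiff h (xs k)) ∧ WeakTendsto vs v}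

/-- Partial limiting subdifferential with respect to the first variable. -/
def pSubdiff {PP : Type*} (g : X → PP → EReal) (x : X) (p : PP) : Set X :=
  limSubdiff (fun x' => g x' p) x

/-- Graph of a set-valued map. -/
def gph (F : X → Set Y) : Set (X × Y) := {t | t.2 ∈ F t.1}

/-- Regular normal cone. -/
def regNC (Ω : Set X) (x : X) : Set X :=
  {v | ∀ ε > (0:ℝ), ∀ᶠ y in 𝓝[Ω] x, ⟪v, y - x⟫ ≤ ε * ‖y - x‖}

/-- Limiting normal cone. -/
def limNC (Ω : Set X) (x : X) : Set X :=
  {v | ∃ xs vs : ℕ → X, (∀ k, xs k ∈ Ω) ∧ Tendsto xs atTop (𝓝 x) ∧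
      (∀ k, vs k ∈ regNC Ω (xs k)) ∧ Tendsto vs atTop (𝓝 v)}

/-- Regular normal cone to a subset of a product of two inner product spaces,
with the Euclidean product norm. -/
def regNC2 (Ω : Set (X × Y)) (ω : X × Y) : Set (X × Y) :=
  {ζ | ∀ ε > (0:ℝ), ∀ᶠ y in 𝓝[Ω] ω,
      ⟪ζ.1, y.1 - ω.1⟫ + ⟪ζ.2, y.2 - ω.2⟫
        ≤ ε * Real.sqrt (‖y.1 - ω.1‖ ^ 2 + ‖y.2 - ω.2‖ ^ 2)}

/-- Limiting normal cone in a product of two spaces. -/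
def limNC2 (Ω : Set (X × Y)) (ω : X × Y) : Set (X × Y) :=
  {ζ | ∃ ωs ζs : ℕ → X × Y, (∀ k, ωs k ∈ Ω) ∧ Tendsto ωs atTop (𝓝 ω) ∧
      (∀ k, ζs k ∈ regNC2 Ω (ωs k)) ∧ Tendsto ζs atTop (𝓝 ζ)}

/-- Regular coderivative of a set-valued map. -/
def regCoderiv (F : X → Set Y) (u : X) (v : Y) (w : Y) : Set X :=
  {z | (z, -w) ∈ regNC2 (gph F) (u, v)}

/-- Limiting coderivative of a set-valued map. -/
def limCoderiv (F : X → Set Y) (u : X) (v : Y) (w : Y) : Set X :=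
  {z | (z, -w) ∈ limNC2 (gph F) (u, v)}

/-- Regular normal cone in a product of three inner product spaces. -/
def regNC3 (Ω : Set (X × W × Y)) (ω : X × W × Y) : Set (X × W × Y) :=
  {ζ | ∀ ε > (0:ℝ), ∀ᶠ y in 𝓝[Ω] ω,
      ⟪ζ.1, y.1 - ω.1⟫ + ⟪ζ.2.1, y.2.1 - ω.2.1⟫ + ⟪ζ.2.2, y.2.2 - ω.2.2⟫
        ≤ ε * Real.sqrt (‖y.1 - ω.1‖ ^ 2 + ‖y.2.1 - ω.2.1‖ ^ 2 + ‖y.2.2 - ω.2.2‖ ^ 2)}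

/-- Limiting normal cone in a product of three inner product spaces. -/
def limNC3 (Ω : Set (X × W × Y)) (ω : X × W × Y) : Set (X × W × Y) :=
  {ζ | ∃ ωs ζs : ℕ → X × W × Y, (∀ k, ωs k ∈ Ω) ∧ Tendsto ωs atTop (𝓝 ω) ∧
      (∀ k, ζs k ∈ regNC3 Ω (ωs k)) ∧ Tendsto ζs atTop (𝓝 ζ)}

/-- Limiting coderivative of the full partial subdifferential map (x,p) ↦ ∂ₓ g(x,p). -/
def limCoderivFull (g : X → W → EReal) (xb : X) (pb : W) (vh : X) (w : X) : Set (X × W) :=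
  {zs | (zs.1, zs.2, -w) ∈ limNC3 {t : X × W × X | t.2.2 ∈ pSubdiff g t.1 t.2.1} (xb, pb, vh)}

/-- Lipschitz-like (Aubin) property of a set-valued map around a graph point. -/
def LipschitzLike {α Z : Type*} [MetricSpace α] [SeminormedAddCommGroup Z]
    (F : α → Set Z) (ab : α) (zb : Z) : Prop :=
  ∃ ℓ > (0:ℝ), ∃ U ∈ 𝓝 ab, ∃ V ∈ 𝓝 zb,
    ∀ a ∈ U, ∀ a' ∈ U, ∀ z ∈ F a ∩ V, ∃ z' ∈ F a', ‖z - z'‖ ≤ ℓ * dist a a'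

/-- Epigraph of g(·,p). -/
def epi {PP : Type*} (g : X → PP → EReal) (p : PP) : Set (X × ℝ) :=
  {q | g q.1 p ≤ (q.2 : EReal)}

/-- (A1): Lipschitz continuity of the base around the reference point. -/
def A1 (f : X → P → Q → X) (xb : X) (pb : P) (qb : Q) : Prop :=
  ∃ L > (0:ℝ), ∃ ε > (0:ℝ), ∀ x₁ x₂ p₁ p₂ q₁ q₂,
    ‖x₁ - xb‖ < ε → ‖x₂ - xb‖ < ε → dist p₁ pb < ε → dist p₂ pb < ε →
    dist q₁ qb < ε → dist q₂ qb < ε →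
    ‖f x₁ p₁ q₁ - f x₂ p₂ q₂‖ ≤ L * (‖x₁ - x₂‖ + dist p₁ p₂ + dist q₁ q₂)

/-- Parametric prox-regularity with prox-parameter r. -/
def ProxRegWith (g : X → P → EReal) (xb : X) (pb : P) (vh : X) (r : ℝ) : Prop :=
  ∃ ε > (0:ℝ), ∀ x u p v, ‖x - xb‖ < ε → ‖u - xb‖ < ε → dist p pb < ε → ‖v - vh‖ < ε →
    v ∈ pSubdiff g u p →
    g u p + ((⟪v, x - u⟫ - r / 2 * ‖x - u‖ ^ 2 : ℝ) : EReal) ≤ g x p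

/-- Subdifferential continuity with compatible parameterization. -/
def SubdiffCont (g : X → P → EReal) (xb : X) (pb : P) (vh : X) : Prop :=
  Tendsto (fun t : X × P × X => g t.1 t.2.1)
    (𝓝[{t : X × P × X | t.2.2 ∈ pSubdiff g t.1 t.2.1}] (xb, pb, vh)) (𝓝 (g xb pb))

/-- (A2): parametric continuous prox-regularity. -/
def A2 (g : X → P → EReal) (xb : X) (pb : P) (vh : X) : Prop :=
  (∃ r > (0:ℝ), ProxRegWith g xb pb vh r) ∧ SubdiffCont g xb pb vh

/-- Threshold of prox-regularity. -/
def proxThreshold (g : X → P → EReal) (xb : X) (pb : P) (vh : X) : ℝ :=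
  sInf {r : ℝ | 0 < r ∧ ProxRegWith g xb pb vh r}

/-- (A3): basic constraint qualification. -/
def A3 (g : X → P → EReal) (xb : X) (pb : P) : Prop :=
  LipschitzLike (fun p => epi g p) pb (xb, (g xb pb).toReal)

/-- (A4): uniform partial differentiability with partial Jacobian continuous at the point. -/
def A4 (f : X → P → Q → X) (Df : X → P → Q → X →L[ℝ] X) (xb : X) (pb : P) (qb : Q) : Prop :=
  (∃ η > (0:ℝ), ∀ ε > (0:ℝ), ∃ δ > (0:ℝ), ∀ x p q,
      ‖x - xb‖ < η → dist p pb < η → dist q qb < η →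
      ∀ x', ‖x' - x‖ < δ →
        ‖f x' p q - f x p q - Df x p q (x' - x)‖ ≤ ε * ‖x' - x‖) ∧
  Tendsto (fun t : X × P × Q => Df t.1 t.2.1 t.2.2) (𝓝 (xb, pb, qb)) (𝓝 (Df xb pb qb))

/-- Solution map of the parametric variational system. -/
def SolMap (f : X → P → Q → X) (g : X → P → EReal) (v : X) (p : P) (q : Q) : Set X :=
  {x | v - f x p q ∈ pSubdiff g x p}

/-- Single-valued localization of a three-parametric solution map. -/
def Localizes3 (S : X → P → Q → Set X) (V : Set X) (Pn : Set P) (Qn : Set Q) (U : Set X)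
    (ϑ : X → P → Q → X) : Prop :=
  ∀ v ∈ V, ∀ p ∈ Pn, ∀ q ∈ Qn,
    ϑ v p q ∈ U ∧ ϑ v p q ∈ S v p q ∧ ∀ x ∈ U, x ∈ S v p q → x = ϑ v p q

/-- Lipschitzian full stability. -/
def LipFullStable (S : X → P → Q → Set X) (xb vb : X) (pb : P) (qb : Q) : Prop :=
  ∃ V ∈ 𝓝 vb, ∃ Pn ∈ 𝓝 pb, ∃ Qn ∈ 𝓝 qb, ∃ U ∈ 𝓝 xb, ∃ ϑ : X → P → Q → X,
    Localizes3 S V Pn Qn U ϑ ∧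
    ∃ κ > (0:ℝ), ∃ ℓ > (0:ℝ), ∀ v₁ ∈ V, ∀ p₁ ∈ Pn, ∀ q₁ ∈ Qn, ∀ v₂ ∈ V, ∀ p₂ ∈ Pn, ∀ q₂ ∈ Qn,
      ‖(v₁ - v₂) - (2 * κ) • (ϑ v₁ p₁ q₁ - ϑ v₂ p₂ q₂)‖
        ≤ ‖v₁ - v₂‖ + ℓ * (dist p₁ p₂ + dist q₁ q₂)

/-- Hölderian full stability with given moduli. -/
def HolderFullStableWith (S : X → P → Q → Set X) (xb vb : X) (pb : P) (qb : Q) (κ ℓ : ℝ) : Prop :=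
  ∃ V ∈ 𝓝 vb, ∃ Pn ∈ 𝓝 pb, ∃ Qn ∈ 𝓝 qb, ∃ U ∈ 𝓝 xb, ∃ ϑ : X → P → Q → X,
    Localizes3 S V Pn Qn U ϑ ∧
    ∀ v₁ ∈ V, ∀ p₁ ∈ Pn, ∀ q₁ ∈ Qn, ∀ v₂ ∈ V, ∀ p₂ ∈ Pn, ∀ q₂ ∈ Qn,
      ‖(v₁ - v₂) - (2 * κ) • (ϑ v₁ p₁ q₁ - ϑ v₂ p₂ q₂)‖
        ≤ ‖v₁ - v₂‖ + ℓ * (Real.sqrt (dist p₁ p₂) + dist q₁ q₂)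

/-- Hölderian full stability. -/
def HolderFullStable (S : X → P → Q → Set X) (xb vb : X) (pb : P) (qb : Q) : Prop :=
  ∃ κ > (0:ℝ), ∃ ℓ > (0:ℝ), HolderFullStableWith S xb vb pb qb κ ℓ

/-- Neighborhood second-order condition via the regular coderivative of ∂g_p. -/
def SOC (g : X → P → EReal) (A : X →L[ℝ] X) (xb : X) (pb : P) (vh : X) (η κ₀ : ℝ) : Prop :=
  ∀ u p v, ‖u - xb‖ ≤ η → dist p pb ≤ η → ‖v - vh‖ ≤ η → v ∈ pSubdiff g u p →
    ∀ w z, z ∈ regCoderiv (fun y => pSubdiff g y p) u v w →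
      κ₀ * ‖w‖ ^ 2 ≤ ⟪A w, w⟫ + ⟪z, w⟫

/-- The graphical map p ↦ gph ∂ₓ g(·,p). -/
def gphMap (g : X → P → EReal) (p : P) : Set (X × X) := {t | t.2 ∈ pSubdiff g t.1 p}

/-- Local strong monotonicity of f in x with modulus σ. -/
def StrongMono (f : X → P → Q → X) (xb : X) (pb : P) (qb : Q) (σ : ℝ) : Prop :=
  ∃ ε > (0:ℝ), ∀ x₁ x₂ p q, ‖x₁ - xb‖ < ε → ‖x₂ - xb‖ < ε → dist p pb < ε → dist q qb < ε →
    σ * ‖x₁ - x₂‖ ^ 2 ≤ ⟪f x₁ p q - f x₂ p q, x₁ - x₂⟫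

/-- The proximal mapping P_λ(v,p) = {x : v ∈ x + λ ∂ₓ g(x,p)}. -/
def proxMap (g : X → P → EReal) (lam : ℝ) (v : X) (p : P) : Set X :=
  {x | ∃ s ∈ pSubdiff g x p, v = x + lam • s}

/-- Single-valued localization of a two-parametric solution map. -/
def Localizes2 (S : X → P → Set X) (V : Set X) (Pn : Set P) (U : Set X) (ϑ : X → P → X) : Prop :=
  ∀ v ∈ V, ∀ p ∈ Pn, ϑ v p ∈ U ∧ ϑ v p ∈ S v p ∧ ∀ x ∈ U, x ∈ S v p → x = ϑ v p

/-- (Lipschitzian) full stability of a two-parametric system. -/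
def FullStable2 (S : X → P → Set X) (xb vb : X) (pb : P) : Prop :=
  ∃ V ∈ 𝓝 vb, ∃ Pn ∈ 𝓝 pb, ∃ U ∈ 𝓝 xb, ∃ ϑ : X → P → X,
    Localizes2 S V Pn U ϑ ∧
    ∃ κ > (0:ℝ), ∃ ℓ > (0:ℝ), ∀ v₁ ∈ V, ∀ p₁ ∈ Pn, ∀ v₂ ∈ V, ∀ p₂ ∈ Pn,
      ‖(v₁ - v₂) - (2 * κ) • (ϑ v₁ p₁ - ϑ v₂ p₂)‖ ≤ ‖v₁ - v₂‖ + ℓ * dist p₁ p₂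

/-- Normal cone of convex analysis. -/
def convNC (C : Set X) (x : X) : Set X := {v | x ∈ C ∧ ∀ y ∈ C, ⟪v, y - x⟫ ≤ 0}

/-- Solution map of a parametric variational inequality. -/
def SolMapVI (f : X → P → X) (C : Set X) (v : X) (p : P) : Set X :=
  {x | v - f x p ∈ convNC C x}

/-- Radial cone. -/
def radialCone (C : Set X) (x : X) : Set X := {w | ∃ t > (0:ℝ), x + t • w ∈ C}

/-- Tangent cone (closure of the radial cone). -/
def tangentC (C : Set X) (x : X) : Set X := closure (radialCone C x)

/-- Critical cone. -/
def criticalCone (C : Set X) (x v : X) : Set X := tangentC C x ∩ {w | ⟪v, w⟫ = 0}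

/-- Polyhedricity of a closed convex set. -/
def Polyhedric (C : Set X) : Prop :=
  ∀ x ∈ C, ∀ v ∈ convNC C x,
    criticalCone C x v = closure (radialCone C x ∩ {w | ⟪v, w⟫ = 0})

/-- Weak sequential outer limit of critical cones. -/
def Hw (C : Set X) (xb vh : X) : Set X :=
  {w | ∃ xs vs ws : ℕ → X, (∀ k, vs k ∈ convNC C (xs k)) ∧
      Tendsto xs atTop (𝓝 xb) ∧ Tendsto vs atTop (𝓝 vh) ∧
      (∀ k, ws k ∈ criticalCone C (xs k) (vs k)) ∧ WeakTendsto ws w}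

/-- Strong sequential outer limit of critical cones. -/
def Hs (C : Set X) (xb vh : X) : Set X :=
  {w | ∃ xs vs ws : ℕ → X, (∀ k, vs k ∈ convNC C (xs k)) ∧
      Tendsto xs atTop (𝓝 xb) ∧ Tendsto vs atTop (𝓝 vh) ∧
      (∀ k, ws k ∈ criticalCone C (xs k) (vs k)) ∧ Tendsto ws atTop (𝓝 w)}

/-- Convex polyhedron: finite intersection of closed half-spaces. -/
def IsPolyhedron (C : Set X) : Prop :=
  ∃ (k : ℕ) (a : Fin k → X) (b : Fin k → ℝ), C = {x | ∀ i, ⟪a i, x⟫ ≤ b i}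

/-- Legendre form. -/
def LegendreForm (Qf : X → ℝ) : Prop :=
  (∃ A : X →L[ℝ] X, ∀ x, Qf x = ⟪A x, x⟫) ∧
  (∀ (xs : ℕ → X) (x : X), WeakTendsto xs x → Qf x ≤ liminf (fun k => Qf (xs k)) atTop) ∧
  (∀ (xs : ℕ → X) (x : X), WeakTendsto xs x →
     Tendsto (fun k => Qf (xs k)) atTop (𝓝 (Qf x)) → Tendsto xs atTop (𝓝 x))

/-- (A1) for a two-parametric base mapping. -/
def A1two (f : X → P → X) (xb : X) (pb : P) : Prop :=
  ∃ L > (0:ℝ), ∃ ε > (0:ℝ), ∀ x₁ x₂ p₁ p₂,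
    ‖x₁ - xb‖ < ε → ‖x₂ - xb‖ < ε → dist p₁ pb < ε → dist p₂ pb < ε →
    ‖f x₁ p₁ - f x₂ p₂‖ ≤ L * (‖x₁ - x₂‖ + dist p₁ p₂)

/-- (A4) for a two-parametric base mapping. -/
def A4two (f : X → P → X) (Df : X → P → X →L[ℝ] X) (xb : X) (pb : P) : Prop :=
  (∃ η > (0:ℝ), ∀ ε > (0:ℝ), ∃ δ > (0:ℝ), ∀ x p,
      ‖x - xb‖ < η → dist p pb < η →
      ∀ x', ‖x' - x‖ < δ → ‖f x' p - f x p - Df x p (x' - x)‖ ≤ ε * ‖x' - x‖) ∧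
  Tendsto (fun t : X × P => Df t.1 t.2) (𝓝 (xb, pb)) (𝓝 (Df xb pb))

/-- Euclidean distance in X × ℝ. -/
def pairDist (a b : X × ℝ) : ℝ := Real.sqrt (‖a.1 - b.1‖ ^ 2 + |a.2 - b.2| ^ 2)

/-- Pompeiu–Hausdorff distance between subsets of X × ℝ (Euclidean product norm). -/
def hausPH (C₁ C₂ : Set (X × ℝ)) : ℝ :=
  sInf {η : ℝ | 0 ≤ η ∧ (∀ a ∈ C₁, ∃ b ∈ C₂, pairDist a b ≤ η) ∧
                 ∀ b ∈ C₂, ∃ a ∈ C₁, pairDist a b ≤ η}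

/-- Nonparametric prox-regularity with parameter r. -/
def ProxRegWithNP (g : X → EReal) (xb vh : X) (r : ℝ) : Prop :=
  ∃ ε > (0:ℝ), ∀ x u v, ‖x - xb‖ < ε → ‖u - xb‖ < ε → ‖v - vh‖ < ε →
    v ∈ limSubdiff g u → g u ≤ g xb + (ε : EReal) →
    g u + ((⟪v, x - u⟫ - r / 2 * ‖x - u‖ ^ 2 : ℝ) : EReal) ≤ g x

/-- Nonparametric subdifferential continuity. -/
def SubdiffContNP (g : X → EReal) (xb vh : X) : Prop :=
  Tendsto (fun t : X × X => g t.1) (𝓝[gph (limSubdiff g)] (xb, vh)) (𝓝 (g xb))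

/-- Nonparametric threshold of prox-regularity. -/
def proxThresholdNP (g : X → EReal) (xb vh : X) : ℝ :=
  sInf {r : ℝ | 0 < r ∧ ProxRegWithNP g xb vh r}

/-- The quadratic perturbation `y ↦ ½⟪B y, y⟫ + (t/2)‖y‖² - ⟪v, y⟫`. -/
def quadPert (B : X →L[ℝ] X) (t : ℝ) (v y : X) : ℝ :=
  1 / 2 * ⟪B y, y⟫ + t / 2 * ‖y‖ ^ 2 - ⟪v, y⟫

lemma quadPert_expand {B : X →L[ℝ] X} (hB : ∀ a b, ⟪B a, b⟫ = ⟪a, B b⟫) (t : ℝ) (v x y : X) :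
    quadPert B t v y = quadPert B t v x - ⟪v - B x - t • x, y - x⟫
      + 1 / 2 * ⟪B (y - x), y - x⟫ + t / 2 * ‖y - x‖ ^ 2 := by
  have h1 : ⟪B y, x⟫ = ⟪B x, y⟫ := by rw [hB, real_inner_comm]
  simp only [quadPert, map_sub, inner_sub_left, inner_sub_right, norm_sub_sq_real,
    real_inner_smul_left, real_inner_self_eq_norm_sq, h1]
  rw [real_inner_comm x y]
  ring

lemma continuous_quadPert (B : X →L[ℝ] X) (t : ℝ) :
    Continuous fun z : X × X => quadPert B t z.1 z.2 := by
  unfold quadPert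
  fun_prop

lemma abs_inner_clm_le (B : X →L[ℝ] X) (d : X) : |⟪B d, d⟫| ≤ ‖B‖ * ‖d‖ ^ 2 := by
  calc |⟪B d, d⟫| ≤ ‖B d‖ * ‖d‖ := abs_real_inner_le_norm _ _
    _ ≤ ‖B‖ * ‖d‖ * ‖d‖ := by gcongr; exact B.le_opNorm d
    _ = _ := by ring

lemma ereal_le_of_add_coe_le {a b c : EReal} (r s : ℝ) (ha : a ≠ ⊥)
    (h : a + (r : EReal) ≤ b + (s : EReal)) (hc : a + ((r - s : ℝ) : EReal) = c) : c ≤ b := by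
  induction a with
  | bot => exact absurd rfl ha
  | top =>
    induction b with
    | bot => simp at h
    | top => exact le_top
    | coe b => exact absurd h (by simp [← EReal.coe_add])
  | coe a =>
    subst hc
    induction b with
    | bot => simp [← EReal.coe_add] at h
    | top => exact le_top
    | coe b => norm_cast at h ⊢; linarith

lemma mem_regSubdiff_of_isLocalMin {h : X → EReal} {x v : X} {B : X →L[ℝ] X} {t : ℝ}
    (hB : ∀ a b, ⟪B a, b⟫ = ⟪a, B b⟫) (htop : h x ≠ ⊤) (hbot : h x ≠ ⊥)
    (hmin : ∀ᶠ y in 𝓝 x,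
      h x + (quadPert B t v x : EReal) ≤ h y + (quadPert B t v y : EReal)) :
    v - B x - t • x ∈ regSubdiff h x := by
  refine ⟨htop, hbot, fun ε hε => ?_⟩
  have hC : 0 < ‖B‖ + |t| + 1 := by positivity
  filter_upwards [hmin, Metric.ball_mem_nhds x (div_pos hε hC)] with y hy hyx
  rw [mem_ball, dist_eq_norm, lt_div_iff₀ hC] at hyx
  have h1 := quadPert_expand hB t v x y
  have h2 := (abs_le.1 (abs_inner_clm_le B (y - x))).2
  have h3 : t / 2 * ‖y - x‖ ^ 2 ≤ |t| / 2 * ‖y - x‖ ^ 2 := by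
    gcongr; exact le_abs_self t
  have h4 : ‖y - x‖ * (‖y - x‖ * (‖B‖ + |t| + 1)) ≤ ‖y - x‖ * ε := by
    gcongr
  have h5 : ⟪v - B x - t • x, y - x⟫ - ε * ‖y - x‖ ≤ quadPert B t v x - quadPert B t v y := by
    nlinarith [sq_nonneg ‖y - x‖, mul_nonneg (norm_nonneg B) (sq_nonneg ‖y - x‖),
      mul_nonneg (abs_nonneg t) (sq_nonneg ‖y - x‖)]
  refine le_trans ?_ (ereal_le_of_add_coe_le _ _ hbot hy rfl)
  gcongr

lemma regSubdiff_subset_limSubdiff (h : X → EReal) (x : X) :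
    regSubdiff h x ⊆ limSubdiff h x := fun v hv =>
  ⟨fun _ => x, fun _ => v, tendsto_const_nhds, tendsto_const_nhds, fun _ => hv,
    fun _ => tendsto_const_nhds⟩

/-- Joint lower semicontinuity against a continuous real minorant. -/
lemma eventually_coe_lt {T : Type*} [TopologicalSpace T] {h : T → EReal} {c : T → ℝ} {x : T}
    (hh : LowerSemicontinuousAt h x) (hc : ContinuousAt c x) (hlt : (c x : EReal) < h x) :
    ∀ᶠ y in 𝓝 x, (c y : EReal) < h y := by
  obtain ⟨m, hm1, hm2⟩ := EReal.lt_iff_exists_real_btwn.1 hlt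
  have h1 : ∀ᶠ y in 𝓝 x, c y < m := hc.eventually_lt continuousAt_const (by exact_mod_cast hm1)
  filter_upwards [h1, hh _ hm2] with y hy1 hy2
  exact lt_trans (by exact_mod_cast hy1) hy2

/-- Stability of strict local minimizers of a quadratically perturbed parametric function. -/
lemma eventually_exists_stationary [FiniteDimensional ℝ X]
    {W : Type*} [NormedAddCommGroup W] [InnerProductSpace ℝ W]
    {g : X → W → EReal} (hlsc : LowerSemicontinuous fun t : X × W => g t.1 t.2)
    (hproper : ∀ x p, g x p ≠ ⊥) {B : X →L[ℝ] X} (hB : ∀ a b, ⟪B a, b⟫ = ⟪a, B b⟫)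
    {u v : X} {p : W} {γ t t₁ ρ : ℝ} (ht : t < t₁) (hρ : 0 < ρ)
    (hquad : ∀ x, ‖x - u‖ < ρ → (γ : EReal) + ((⟪v, x - u⟫ - 1 / 2 * ⟪B (x - u), x - u⟫
      - t / 2 * ‖x - u‖ ^ 2 : ℝ) : EReal) ≤ g x p)
    (hinner : ∀ δ > 0, ∀ᶠ p' in 𝓝 p, ∃ x', ‖x' - u‖ < δ ∧ g x' p' < ((γ + δ : ℝ) : EReal))
    {ρ' : ℝ} (hρ' : 0 < ρ') :
    ∀ᶠ z : W × X in 𝓝 (p, v + B u + t₁ • u), ∃ x, ‖x - u‖ < ρ' ∧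
      z.2 - B x - t₁ • x ∈ pSubdiff g x z.1 := by
  set vb := v + B u + t₁ • u with hvb
  set r := min ρ' (ρ / 2) with hr
  have hr0 : 0 < r := lt_min hρ' (by linarith)
  have hrρ : r < ρ := (min_le_right _ _).trans_lt (by linarith)
  set c := (t₁ - t) * r ^ 2 with hc
  have hc0 : 0 < c := by have : 0 < t₁ - t := by linarith
                         positivity
  set b := γ + quadPert B t₁ vb u + c / 4 with hb
  have hsphere : ∀ᶠ z : W × X in 𝓝 (p, vb), ∀ x ∈ sphere u r,
      ((b - quadPert B t₁ z.2 x : ℝ) : EReal) < g x z.1 := by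
    apply (isCompact_sphere u r).eventually_forall_of_forall_eventually
    intro x hx
    rw [mem_sphere, dist_eq_norm] at hx
    have hl : LowerSemicontinuousAt (fun y : (W × X) × X => g y.2 y.1.1) ((p, vb), x) :=
      fun m hm =>
      (Continuous.tendsto (f := fun y : (W × X) × X => (y.2, y.1.1)) (by fun_prop)
        ((p, vb), x)).eventually (hlsc (x, p) m hm)
    refine eventually_coe_lt (c := fun y : (W × X) × X => b - quadPert B t₁ y.1.2 y.2) hl ?_ ?_
    · exact (continuous_const.sub ((continuous_quadPert B t₁).comp
        (g := fun z : X × X => quadPert B t₁ z.1 z.2)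
        (f := fun y : (W × X) × X => (y.1.2, y.2)) (by fun_prop))).continuousAt
    · refine lt_of_lt_of_le ?_ (hquad x (by rw [hx]; exact hrρ))
      have h1 := quadPert_expand hB t₁ vb u x
      have h2 : vb - B u - t₁ • u = v := by rw [hvb]; abel
      rw [h2, hx] at h1
      rw [hx]
      norm_cast
      simp only [hb]
      rw [h1]
      nlinarith
  have hcont : ∀ᶠ y : X × X in 𝓝 (vb, u), quadPert B t₁ y.1 y.2 < quadPert B t₁ vb u + c / 8 :=
    (continuous_quadPert B t₁).continuousAt.eventually_lt continuousAt_const (by simp; linarith)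
  rw [nhds_prod_eq] at hcont
  obtain ⟨P1, hP1, P2, hP2, hP⟩ := eventually_prod_iff.1 hcont
  obtain ⟨δ, hδ, hδP⟩ := Metric.eventually_nhds_iff.1 hP2
  have hin := hinner (min δ (min r (c / 8))) (by positivity)
  have e1 : ∀ᶠ z : W × X in 𝓝 (p, vb), ∃ x', ‖x' - u‖ < min δ (min r (c / 8)) ∧
      g x' z.1 < ((γ + min δ (min r (c / 8)) : ℝ) : EReal) :=
    (continuous_fst.tendsto (p, vb)).eventually hin
  have e2 : ∀ᶠ z : W × X in 𝓝 (p, vb), P1 z.2 := (continuous_snd.tendsto (p, vb)).eventually hP1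
  filter_upwards [hsphere, e1, e2] with z hz1 ⟨x', hx', hgx'⟩ hz3
  have hlz : LowerSemicontinuous fun x => g x z.1 + (quadPert B t₁ z.2 x : EReal) := by
    refine LowerSemicontinuous.add' (fun y m hm =>
      ((Continuous.prodMk_left z.1).tendsto y).eventually (hlsc (y, z.1) m hm)) ?_ ?_
    · exact (continuous_coe_real_ereal.comp ((continuous_quadPert B t₁).comp
        (g := fun z : X × X => quadPert B t₁ z.1 z.2)
        (f := fun y : X => (z.2, y)) (by fun_prop))).lowerSemicontinuous
    · intro x
      exact EReal.continuousAt_add (by simp) (by simp)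
  obtain ⟨x, hxb, hxmin⟩ := LowerSemicontinuousOn.exists_isMinOn
    (nonempty_closedBall.2 hr0.le) (isCompact_closedBall u r) (hlz.lowerSemicontinuousOn _)
  have hx'δ : ‖x' - u‖ < δ := hx'.trans_le (min_le_left _ _)
  have hx'r : ‖x' - u‖ < r := hx'.trans_le ((min_le_right _ _).trans (min_le_left _ _))
  have hmc : min δ (min r (c / 8)) ≤ c / 8 := (min_le_right _ _).trans (min_le_right _ _)
  have hq' := hP hz3 (hδP (y := x') (by rwa [dist_eq_norm]))
  simp only at hq'
  have hval : g x z.1 + (quadPert B t₁ z.2 x : EReal) < (b : EReal) := by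
    refine lt_of_le_of_lt (hxmin (a := x') (by rw [mem_closedBall, dist_eq_norm]; exact hx'r.le)) ?_
    have hb' : g x' z.1 ≠ ⊥ := hproper _ _
    change g x' z.1 + (quadPert B t₁ z.2 x' : EReal) < (b : EReal)
    generalize g x' z.1 = a at hgx' hb' ⊢
    induction a with
    | bot => exact absurd rfl hb'
    | top => exact absurd hgx' (by simp)
    | coe a =>
      norm_cast at hgx' ⊢
      linarith
  have htop : g x z.1 ≠ ⊤ := by
    intro h
    rw [h] at hval
    simp at hval
  have hxlt : ‖x - u‖ < r := by
    rw [mem_closedBall, dist_eq_norm] at hxb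
    refine lt_of_le_of_ne hxb fun heq => ?_
    have h1 := hz1 x (by rw [mem_sphere, dist_eq_norm]; exact heq)
    have hb' : g x z.1 ≠ ⊥ := hproper _ _
    generalize g x z.1 = a at *
    induction a with
    | bot => exact absurd rfl hb'
    | top => exact absurd rfl htop
    | coe a =>
      norm_cast at h1 hval
      linarith
  refine ⟨x, hxlt.trans_le (min_le_left _ _), ?_⟩
  refine regSubdiff_subset_limSubdiff _ _
    (mem_regSubdiff_of_isLocalMin hB htop (hproper _ _) ?_)
  filter_upwards [isOpen_ball.mem_nhds (show x ∈ ball u r by rwa [mem_ball, dist_eq_norm])]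
    with y hy
  exact hxmin (ball_subset_closedBall hy)

/-- Points of the graph of the partial subdifferential in the `ε`-box around the reference. -/
def NearGph (g : X → P → EReal) (xb : X) (pb : P) (vh : X) (ε : ℝ) (x : X) (p : P) (v : X) :
    Prop :=
  v ∈ pSubdiff g x p ∧ ‖x - xb‖ < ε ∧ dist p pb < ε ∧ ‖v - vh‖ < ε

lemma NearGph.mono {g : X → P → EReal} {xb : X} {pb : P} {vh : X} {ε ε' : ℝ} {x : X} {p : P}
    {v : X} (h : NearGph g xb pb vh ε x p v) (hε : ε ≤ ε') : NearGph g xb pb vh ε' x p v :=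
  ⟨h.1, h.2.1.trans_le hε, h.2.2.1.trans_le hε, h.2.2.2.trans_le hε⟩

/-- Local subgradient inequality with the quadratic correction `½⟪B ·, ·⟫ + (t/2)‖·‖²`. -/
def QuadMinorant (g : X → P → EReal) (xb : X) (pb : P) (vh : X) (B : X →L[ℝ] X) (t ε : ℝ) :
    Prop :=
  ∀ u p v, NearGph g xb pb vh ε u p v → ∀ x, ‖x - xb‖ < ε →
    g u p + ((⟪v, x - u⟫ - 1 / 2 * ⟪B (x - u), x - u⟫ - t / 2 * ‖x - u‖ ^ 2 : ℝ) : EReal)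
      ≤ g x p

/-- Finiteness and inner semicontinuity of epigraphs at nearby points of the graph. -/
def InnerReg (g : X → P → EReal) (xb : X) (pb : P) (vh : X) (ε : ℝ) : Prop :=
  ∀ u p v, NearGph g xb pb vh ε u p v → ∃ γ : ℝ, g u p = γ ∧
    ∀ δ > 0, ∀ᶠ p' in 𝓝 p, ∃ x', ‖x' - u‖ < δ ∧ g x' p' < ((γ + δ : ℝ) : EReal)

lemma QuadMinorant.mono {g : X → P → EReal} {xb : X} {pb : P} {vh : X} {B : X →L[ℝ] X}
    {t t' ε ε' : ℝ} (h : QuadMinorant g xb pb vh B t ε) (ht : t ≤ t') (hε : ε' ≤ ε) :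
    QuadMinorant g xb pb vh B t' ε' := by
  intro u p v hu x hx
  refine le_trans ?_ (h u p v (hu.mono hε) x (hx.trans_le hε))
  gcongr

lemma InnerReg.mono {g : X → P → EReal} {xb : X} {pb : P} {vh : X}
    {ε ε' : ℝ} (h : InnerReg g xb pb vh ε) (hε : ε' ≤ ε) :
    InnerReg g xb pb vh ε' := fun u p v hu => h u p v (hu.mono hε)

lemma QuadMinorant.of_proxRegWith {g : X → P → EReal} {xb : X} {pb : P} {vh : X} {r : ℝ}
    (h : ProxRegWith g xb pb vh r) (B : X →L[ℝ] X) :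
    ∃ ε > 0, QuadMinorant g xb pb vh B (r + ‖B‖) ε := by
  obtain ⟨ε, hε, h⟩ := h
  refine ⟨ε, hε, fun u p v hu x hx => le_trans ?_ (h x u p v hx hu.2.1 hu.2.2.1 hu.2.2.2 hu.1)⟩
  have := (abs_le.1 (abs_inner_clm_le B (x - u))).1
  gcongr _ + ((?_ : ℝ) : EReal)
  linarith

lemma ne_top_of_proxRegWith {PP : Type*} {g : X → PP → EReal} {xb u v : X} {p : PP}
    {ε r : ℝ} (hu : ‖u - xb‖ < ε)
    (h : ∀ x, ‖x - xb‖ < ε →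
      g u p + ((⟪v, x - u⟫ - r / 2 * ‖x - u‖ ^ 2 : ℝ) : EReal) ≤ g x p)
    (hv : v ∈ pSubdiff g u p) : g u p ≠ ⊤ := by
  obtain ⟨xs, vs, hxs, -, hvs, -⟩ := hv
  have h1 : ∀ᶠ k in atTop, xs k ∈ ball xb ε :=
    hxs.eventually (isOpen_ball.mem_nhds (by rwa [mem_ball, dist_eq_norm]))
  obtain ⟨k, hk⟩ := h1.exists
  rw [mem_ball, dist_eq_norm] at hk
  intro htop
  have h2 := h _ hk
  rw [htop, EReal.top_add_coe, top_le_iff] at h2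
  exact (hvs k).1 h2

lemma exists_innerReg {g : X → P → EReal} {xb : X} {pb : P} {vh : X}
    (hproper : ∀ x p, g x p ≠ ⊥) (hmem : vh ∈ pSubdiff g xb pb)
    (hA2 : A2 g xb pb vh) (hA3 : A3 g xb pb) : ∃ ε > 0, InnerReg g xb pb vh ε := by
  obtain ⟨⟨r, -, ε₁, hε₁, hprox⟩, hcont⟩ := hA2
  obtain ⟨ℓ, hℓ, U, hU, V, hV, hLip⟩ := hA3
  have hfin : ∀ u p v, NearGph g xb pb vh ε₁ u p v → g u p = ((g u p).toReal : EReal) :=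
    fun u p v hu => (EReal.coe_toReal (ne_top_of_proxRegWith hu.2.1
      (fun x hx => hprox x u p v hx hu.2.1 hu.2.2.1 hu.2.2.2 hu.1) hu.1) (hproper _ _)).symm
  set γ₀ := (g xb pb).toReal with hγ₀
  have hγ : g xb pb = (γ₀ : EReal) := hfin xb pb vh ⟨hmem, by simpa, by simpa, by simpa⟩
  obtain ⟨ε₂, hε₂, hV⟩ := Metric.mem_nhds_iff.1 hV
  obtain ⟨ε₃, hε₃, hU⟩ := Metric.mem_nhds_iff.1 hU
  have hnhds : Ioo ((γ₀ - ε₂ : ℝ) : EReal) ((γ₀ + ε₂ : ℝ) : EReal) ∈ 𝓝 (g xb pb) := by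
    rw [hγ]
    exact Ioo_mem_nhds (by norm_cast; linarith) (by norm_cast; linarith)
  obtain ⟨ε₄, hε₄, h4⟩ := Metric.eventually_nhds_iff.1
    (eventually_nhdsWithin_iff.1 (hcont.eventually hnhds))
  refine ⟨min (min ε₁ ε₂) (min ε₃ ε₄), by positivity, fun u p v hu => ?_⟩
  have hu1 := hu.mono ((min_le_left _ _).trans (min_le_left _ _))
  have hu2 := hu.mono ((min_le_left _ _).trans (min_le_right _ _))
  have hu3 := hu.mono ((min_le_right _ _).trans (min_le_left _ _))
  have hu4 := hu.mono ((min_le_right _ _).trans (min_le_right _ _))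
  have hγu := hfin u p v hu1
  set γ := (g u p).toReal
  refine ⟨γ, hγu, fun δ hδ => ?_⟩
  have h5 := h4 (y := (u, p, v)) (by
    rw [Prod.dist_eq, Prod.dist_eq, dist_eq_norm, dist_eq_norm v]
    exact max_lt hu4.2.1 (max_lt hu4.2.2.1 hu4.2.2.2)) hu.1
  simp only [hγu, EReal.coe_lt_coe_iff] at h5
  have hpU : ball pb ε₃ ∈ 𝓝 p := isOpen_ball.mem_nhds hu3.2.2.1
  filter_upwards [hpU, Metric.ball_mem_nhds p (div_pos hδ hℓ)] with p' hp' hpp'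
  obtain ⟨z', hz', hd⟩ := hLip p (hU hu3.2.2.1) p' (hU hp') (u, γ)
    ⟨hγu.le, hV (by
      rw [mem_ball, Prod.dist_eq, dist_eq_norm, Real.dist_eq]
      exact max_lt hu2.2.1 (abs_lt.2 ⟨by linarith, by linarith⟩))⟩
  rw [mem_ball, dist_comm, lt_div_iff₀ hℓ, mul_comm] at hpp'
  have hd' := hd.trans_lt hpp'
  rw [Prod.norm_def] at hd'
  have hd1 := (le_max_left _ _).trans_lt hd'
  have hd2 := (le_max_right _ _).trans_lt hd'
  simp only [Prod.fst_sub, Prod.snd_sub, Real.norm_eq_abs] at hd1 hd2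
  refine ⟨z'.1, by rwa [norm_sub_rev], lt_of_le_of_lt hz' ?_⟩
  norm_cast
  linarith [(abs_lt.1 hd2).1]

lemma QuadMinorant.le_inner {g : X → P → EReal} {xb : X} {pb : P} {vh : X} {B : X →L[ℝ] X}
    {t ε : ℝ} (hq : QuadMinorant g xb pb vh B t ε) (hin : InnerReg g xb pb vh ε) (T : ℝ)
    {p : P} {x₁ x₂ v₁ v₂ : X} (h₁ : NearGph g xb pb vh ε x₁ p v₁)
    (h₂ : NearGph g xb pb vh ε x₂ p v₂) :
    (T - t) * ‖x₁ - x₂‖ ^ 2 ≤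
      ⟪(v₁ + B x₁ + T • x₁) - (v₂ + B x₂ + T • x₂), x₁ - x₂⟫ := by
  obtain ⟨γ₁, hγ₁, -⟩ := hin _ _ _ h₁
  obtain ⟨γ₂, hγ₂, -⟩ := hin _ _ _ h₂
  have e1 := hq _ _ _ h₁ x₂ h₂.2.1
  have e2 := hq _ _ _ h₂ x₁ h₁.2.1
  rw [hγ₁, hγ₂] at e1 e2
  norm_cast at e1 e2
  have h3 : x₂ - x₁ = -(x₁ - x₂) := by abel
  rw [h3] at e1
  simp only [inner_neg_right, map_neg, inner_neg_left, norm_neg, neg_neg] at e1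
  have h4 : (v₁ + B x₁ + T • x₁) - (v₂ + B x₂ + T • x₂)
      = (v₁ - v₂) + B (x₁ - x₂) + T • (x₁ - x₂) := by
    rw [map_sub, smul_sub]; abel
  rw [h4, inner_add_left, inner_add_left, real_inner_smul_left, real_inner_self_eq_norm_sq,
    inner_sub_left]
  linarith

lemma QuadMinorant.eq_of_eq {g : X → P → EReal} {xb : X} {pb : P} {vh : X} {B : X →L[ℝ] X}
    {t ε : ℝ} (hq : QuadMinorant g xb pb vh B t ε) (hin : InnerReg g xb pb vh ε) {T : ℝ}
    (hT : t < T) {p : P} {x₁ x₂ v₁ v₂ : X} (h₁ : NearGph g xb pb vh ε x₁ p v₁)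
    (h₂ : NearGph g xb pb vh ε x₂ p v₂) (he : v₁ + B x₁ + T • x₁ = v₂ + B x₂ + T • x₂) :
    x₁ = x₂ := by
  have h := hq.le_inner hin T h₁ h₂
  rw [he, sub_self, inner_zero_left] at h
  have : ‖x₁ - x₂‖ ^ 2 ≤ 0 := by
    by_contra hc
    nlinarith
  exact sub_eq_zero.1 (norm_eq_zero.1 (by nlinarith [norm_nonneg (x₁ - x₂)]))

lemma eventually_exists_resolvent [FiniteDimensional ℝ X]
    {g : X → W → EReal} (hlsc : LowerSemicontinuous fun t : X × W => g t.1 t.2)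
    (hproper : ∀ x p, g x p ≠ ⊥) {B : X →L[ℝ] X} (hB : ∀ a b, ⟪B a, b⟫ = ⟪a, B b⟫)
    {xb vh u v : X} {pb p : W} {t T ε ε' ρ : ℝ} (hq : QuadMinorant g xb pb vh B t ε)
    (hin : InnerReg g xb pb vh ε) (hT : t < T) (hε' : ε' ≤ ε)
    (hu : NearGph g xb pb vh ε' u p v) (hρ : 0 < ρ) :
    ∀ᶠ z : W × X in 𝓝 (p, v + B u + T • u), ∃ x, ‖x - u‖ < ρ ∧
      NearGph g xb pb vh ε' x z.1 (z.2 - B x - T • x) := by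
  obtain ⟨γ, hγ, hinner⟩ := hin _ _ _ (hu.mono hε')
  have hcont : ∀ᶠ y : (W × X) × X in 𝓝 ((p, v + B u + T • u), u),
      ‖y.2 - xb‖ < ε' ∧ dist y.1.1 pb < ε' ∧ ‖y.1.2 - B y.2 - T • y.2 - vh‖ < ε' := by
    have h1 : v + B u + T • u - B u - T • u - vh = v - vh := by abel
    have c1 : Continuous fun y : (W × X) × X => ‖y.2 - xb‖ := by fun_prop
    have c2 : Continuous fun y : (W × X) × X => dist y.1.1 pb := by fun_prop
    have c3 : Continuous fun y : (W × X) × X => ‖y.1.2 - B y.2 - T • y.2 - vh‖ := by fun_prop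
    exact (c1.continuousAt.eventually_lt continuousAt_const hu.2.1).and
      ((c2.continuousAt.eventually_lt continuousAt_const hu.2.2.1).and
        (c3.continuousAt.eventually_lt continuousAt_const (by simpa [h1] using hu.2.2.2)))
  rw [nhds_prod_eq] at hcont
  obtain ⟨P1, hP1, P2, hP2, hP⟩ := eventually_prod_iff.1 hcont
  obtain ⟨δ, hδ, hδP⟩ := Metric.eventually_nhds_iff.1 hP2
  have hmain := eventually_exists_stationary hlsc hproper hB (u := u) (v := v) (p := p) (γ := γ)
    hT (ρ := ε - ‖u - xb‖) (by linarith [hu.2.1]) (fun x hx => by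
      rw [← hγ]
      refine hq _ _ _ (hu.mono hε') x ?_
      calc ‖x - xb‖ = ‖(x - u) + (u - xb)‖ := by congr 1; abel
        _ ≤ ‖x - u‖ + ‖u - xb‖ := norm_add_le _ _
        _ < ε := by linarith) hinner (ρ' := min ρ δ) (lt_min hρ hδ)
  filter_upwards [hmain, hP1] with z ⟨x, hx, hmem⟩ hz
  have h2 := hP hz (hδP (y := x) (by rw [dist_eq_norm]; exact hx.trans_le (min_le_right _ _)))
  exact ⟨x, hx.trans_le (min_le_left _ _), hmem, h2⟩

/-- The localized resolvent `(p, y) ↦ x` with `y ∈ ∂ₓg(x, p) + B x + T x` is a continuous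
function near the reference. -/
lemma exists_resolvent [FiniteDimensional ℝ X]
    {g : X → W → EReal} (hlsc : LowerSemicontinuous fun t : X × W => g t.1 t.2)
    (hproper : ∀ x p, g x p ≠ ⊥) {B : X →L[ℝ] X} (hB : ∀ a b, ⟪B a, b⟫ = ⟪a, B b⟫)
    {xb vh : X} {pb : W} {t T ε ε' : ℝ} (hmem : vh ∈ pSubdiff g xb pb)
    (hq : QuadMinorant g xb pb vh B t ε)
    (hin : InnerReg g xb pb vh ε) (hT : t < T) (hε' : ε' ≤ ε) (hε0 : 0 < ε') :
    ∃ η > 0, ∃ Θ : W × X → X, ContinuousOn Θ (ball (pb, vh + B xb + T • xb) η) ∧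
      ∀ z ∈ ball (pb, vh + B xb + T • xb) η,
        NearGph g xb pb vh ε' (Θ z) z.1 (z.2 - B (Θ z) - T • Θ z) := by
  have h0 := eventually_exists_resolvent hlsc hproper hB hq hin hT hε'
    (u := xb) (p := pb) (v := vh) ⟨hmem, by simpa, by simpa, by simpa⟩ hε0
  obtain ⟨η, hη, h1⟩ := Metric.eventually_nhds_iff.1 h0
  replace h1 : ∀ z, z ∈ ball (pb, vh + B xb + T • xb) η → ∃ x, ‖x - xb‖ < ε' ∧
      NearGph g xb pb vh ε' x z.1 (z.2 - B x - T • x) := fun z hz => h1 hz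
  choose! Θ hΘ using h1
  refine ⟨η, hη, Θ, fun z hz => ContinuousAt.continuousWithinAt ?_, fun z hz => (hΘ z hz).2⟩
  rw [Metric.continuousAt_iff']
  intro ρ hρ
  have h2 := eventually_exists_resolvent hlsc hproper hB hq hin hT hε' (hΘ z hz).2 hρ
  have h3 : (z.1, z.2 - B (Θ z) - T • Θ z + B (Θ z) + T • Θ z) = z := by
    refine Prod.ext rfl ?_
    simp only
    abel
  rw [h3] at h2
  filter_upwards [h2, isOpen_ball.mem_nhds hz] with y ⟨x, hx, hxg⟩ hy
  have : Θ y = x := hq.eq_of_eq hin hT ((hΘ y hy).2.mono hε') (hxg.mono hε') (by abel)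
  rw [this, dist_eq_norm]
  exact hx

/-- A continuous map all of whose scalarizations have Fréchet subgradients bounded by `ℓ` is
locally Lipschitz with any larger modulus. -/
lemma lipschitz_of_subgradient_bound {Z : Type*} [NormedAddCommGroup Z] [InnerProductSpace ℝ Z]
    [FiniteDimensional ℝ Z] {F : Z → X} {zb : Z} {R ℓ : ℝ} (hR : 0 < R) (hℓ : 0 ≤ ℓ)
    (hF : ContinuousOn F (ball zb R))
    (hsub : ∀ z ∈ ball zb R, ∀ (w : X) (ζ : Z),
      (∀ ε > 0, ∀ᶠ y in 𝓝 z, ⟪ζ, y - z⟫ ≤ ⟪w, F y - F z⟫ + ε * ‖y - z‖) → ‖ζ‖ ≤ ℓ * ‖w‖) :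
    ∃ ρ > 0, ∀ a ∈ ball zb ρ, ∀ b ∈ ball zb ρ, ‖F a - F b‖ ≤ (ℓ + 2) * ‖a - b‖ := by
  have hcb : ContinuousAt F zb := hF.continuousAt (ball_mem_nhds _ hR)
  obtain ⟨R₁, hR₁, hosc⟩ := Metric.continuousAt_iff.1 hcb 1 one_pos
  set r := min R R₁ / 2 with hr
  have hr0 : 0 < r := by positivity
  have hrR : 2 * r ≤ R := by rw [hr]; linarith [min_le_left R R₁]
  have hrR₁ : 2 * r ≤ R₁ := by rw [hr]; linarith [min_le_right R R₁]
  set K := 3 / r ^ 2 with hK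
  have hK0 : 0 < K := by positivity
  refine ⟨min (r / 2) (1 / (2 * K)), by positivity, fun a ha b hb => ?_⟩
  have har' : dist a zb < r / 2 := ha.trans_le (min_le_left _ _)
  have har : dist a zb < r := by linarith
  have hbr : dist b zb < r / 2 := hb.trans_le (min_le_left _ _)
  by_contra hcon
  push Not at hcon
  set D := F b - F a with hD
  have hDn : (ℓ + 2) * ‖b - a‖ < ‖D‖ := by
    rw [hD, norm_sub_rev b a, norm_sub_rev (F b) (F a)]; exact hcon
  have hba : 0 < ‖b - a‖ := by
    rcases (norm_nonneg (b - a)).eq_or_lt with h | h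
    · have : b = a := sub_eq_zero.1 (norm_eq_zero.1 h.symm)
      rw [← h, hD, this] at hDn
      simp at hDn
    · exact h
  have hD0 : 0 < ‖D‖ := lt_of_le_of_lt (by positivity) hDn
  have hKba : K * ‖b - a‖ ≤ 1 := by
    have h1 : dist b a ≤ dist b zb + dist a zb := dist_triangle_right _ _ _
    have h2 : dist b zb < 1 / (2 * K) := lt_of_lt_of_le hb (min_le_right _ _)
    have h3 : dist a zb < 1 / (2 * K) := lt_of_lt_of_le ha (min_le_right _ _)
    rw [← dist_eq_norm]
    have h4 : dist b a ≤ 1 / K := by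
      have : 1 / (2 * K) + 1 / (2 * K) = 1 / K := by field_simp; norm_num
      linarith
    calc K * dist b a ≤ K * (1 / K) := by gcongr
      _ = 1 := by field_simp
  set w : X := -(‖D‖⁻¹ • D) with hw
  have hwn : ‖w‖ = 1 := by
    rw [hw, norm_neg, norm_smul, norm_inv, norm_norm]
    field_simp
  have hwD : ⟪w, D⟫ = -‖D‖ := by
    rw [hw, inner_neg_left, real_inner_smul_left, real_inner_self_eq_norm_sq]
    field_simp
  set pen : Z → ℝ := fun z => (ℓ + 1) * ‖z - a‖ + K * ‖z - a‖ ^ 2 with hpen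
  set Φ : Z → ℝ := fun z => ⟪w, F z - F a⟫ + pen z with hΦ
  have hsubset : closedBall a r ⊆ ball zb R := fun z hz => by
    rw [mem_ball]
    calc dist z zb ≤ dist z a + dist a zb := dist_triangle _ _ _
      _ < r + r := add_lt_add_of_le_of_lt hz har
      _ ≤ R := by linarith
  have hΦc : ContinuousOn Φ (closedBall a r) := by
    have := hF.mono hsubset
    fun_prop
  obtain ⟨z, hz, hzmin⟩ := (isCompact_closedBall a r).exists_isMinOn
    (nonempty_closedBall.2 hr0.le) hΦc
  have hΦa : Φ a = 0 := by simp [hΦ, hpen]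
  have hza : Φ z ≤ 0 := by
    rw [← hΦa]; exact hzmin (mem_closedBall_self hr0.le)
  have hosc2 : ∀ y ∈ closedBall a r, -2 ≤ ⟪w, F y - F a⟫ := by
    intro y hy
    have h1 : dist y zb < R₁ := by
      calc dist y zb ≤ dist y a + dist a zb := dist_triangle _ _ _
        _ < r + r := add_lt_add_of_le_of_lt hy har
        _ ≤ R₁ := by linarith
    have h2 := hosc h1
    have h3 : dist (F a) (F zb) < 1 := hosc (by linarith)
    have h4 : ‖F y - F a‖ ≤ 2 := by
      rw [← dist_eq_norm]
      linarith [dist_triangle_right (F y) (F a) (F zb)]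
    have h5 := (abs_le.1 (abs_real_inner_le_norm w (F y - F a))).1
    rw [hwn, one_mul] at h5
    linarith
  have hzr : ‖z - a‖ < r := by
    have hz' : ‖z - a‖ ≤ r := by rwa [← dist_eq_norm]
    refine lt_of_le_of_ne hz' fun heq => ?_
    have h1 := hosc2 z hz
    have h2 : K * r ^ 2 = 3 := by rw [hK]; field_simp
    have h3 : Φ z = ⟪w, F z - F a⟫ + ((ℓ + 1) * r + 3) := by
      simp only [hΦ, hpen, heq, h2]
    have : 0 ≤ (ℓ + 1) * r := by positivity
    linarith
  have hΦb : Φ b < 0 := by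
    have h1 : Φ b = -‖D‖ + ((ℓ + 1) * ‖b - a‖ + K * ‖b - a‖ * ‖b - a‖) := by
      simp only [hΦ, hpen, ← hD, hwD]; ring
    have h2 : K * ‖b - a‖ * ‖b - a‖ ≤ 1 * ‖b - a‖ := by gcongr
    linarith
  have hbcl : b ∈ closedBall a r := by
    rw [mem_closedBall]
    linarith [dist_triangle_right b a zb]
  have hzne : z ≠ a := by
    rintro rfl
    have := hzmin hbcl
    exact absurd (hΦa.symm.trans_le this) (not_le.2 hΦb)
  have hza0 : 0 < ‖z - a‖ := norm_pos_iff.2 (sub_ne_zero.2 hzne)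
  set ζ : Z := -(((ℓ + 1) * ‖z - a‖⁻¹ + 2 * K) • (z - a)) with hζ
  have hζn : ‖ζ‖ = (ℓ + 1) + 2 * K * ‖z - a‖ := by
    rw [hζ, norm_neg, norm_smul, Real.norm_eq_abs, abs_of_nonneg (by positivity)]
    field_simp
  have hζle : ‖ζ‖ ≤ ℓ * ‖w‖ := by
    refine hsub z (hsubset hz) w ζ fun ε hε => ?_
    have hd1 : HasFDerivAt pen (innerSL ℝ (-ζ)) z := by
      have hs : HasFDerivAt (fun y : Z => ‖y - a‖ ^ 2) (2 • innerSL ℝ (z - a)) z := by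
        simpa using ((hasFDerivAt_id z).sub_const a).norm_sq
      have hn : HasFDerivAt (fun y : Z => ‖y - a‖) (‖z - a‖⁻¹ • innerSL ℝ (z - a)) z := by
        have h := hs.sqrt (by positivity)
        have e : (fun y : Z => √(‖y - a‖ ^ 2)) = fun y => ‖y - a‖ := by
          ext y; exact Real.sqrt_sq (norm_nonneg _)
        rw [e] at h
        convert h using 1
        ext y
        simp only [Real.sqrt_sq (norm_nonneg _), smul_apply, smul_eq_mul,
          nsmul_eq_mul]
        field_simp
        simp
      have h := (hn.const_mul (ℓ + 1)).add (hs.const_mul K)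
      have e : (ℓ + 1) • (‖z - a‖⁻¹ • innerSL ℝ (z - a)) + K • (2 • innerSL ℝ (z - a))
          = innerSL ℝ (-ζ) := by
        ext y
        simp only [add_apply, smul_apply, hζ, neg_neg,
          innerSL_apply_apply, real_inner_smul_left, smul_eq_mul, nsmul_eq_mul]
        push_cast
        ring
      rw [e] at h
      exact h
    have hlo := hd1.isLittleO.def hε
    filter_upwards [hlo, isOpen_ball.mem_nhds (show z ∈ ball a r by
      rwa [mem_ball, dist_eq_norm])] with y hy hyb
    have h1 : Φ z ≤ Φ y := hzmin (ball_subset_closedBall hyb)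
    have h2 : ⟪w, F y - F z⟫ = ⟪w, F y - F a⟫ - ⟪w, F z - F a⟫ := by
      rw [← inner_sub_right]; congr 1; abel
    have h3 := (abs_le.1 hy).2
    rw [innerSL_apply_apply, inner_neg_left] at h3
    simp only [hΦ] at h1
    linarith
  rw [hζn, hwn] at hζle
  have : 0 < K * ‖z - a‖ := by positivity
  linarith

/-- Graph of the partial subdifferential map. -/
def subGraph (g : X → W → EReal) : Set (X × W × X) := {t | t.2.2 ∈ pSubdiff g t.1 t.2.1}

lemma mem_regNC3_iff {Ω : Set (X × W × Y)} {ω ζ : X × W × Y} :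
    ζ ∈ regNC3 Ω ω ↔ ∀ ε > (0:ℝ), ∀ᶠ y in 𝓝[Ω] ω,
      ⟪ζ.1, y.1 - ω.1⟫ + ⟪ζ.2.1, y.2.1 - ω.2.1⟫ + ⟪ζ.2.2, y.2.2 - ω.2.2⟫
        ≤ ε * (‖y.1 - ω.1‖ + ‖y.2.1 - ω.2.1‖ + ‖y.2.2 - ω.2.2‖) := by
  constructor
  · intro h ε hε
    filter_upwards [h ε hε] with y hy
    refine hy.trans (mul_le_mul_of_nonneg_left (Real.sqrt_le_iff.2 ⟨by positivity, ?_⟩) hε.le)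
    nlinarith [mul_nonneg (norm_nonneg (y.1 - ω.1)) (norm_nonneg (y.2.1 - ω.2.1)),
      mul_nonneg (norm_nonneg (y.1 - ω.1)) (norm_nonneg (y.2.2 - ω.2.2)),
      mul_nonneg (norm_nonneg (y.2.1 - ω.2.1)) (norm_nonneg (y.2.2 - ω.2.2))]
  · intro h ε hε
    filter_upwards [h (ε / 3) (by positivity)] with y hy
    have h1 : ‖y.1 - ω.1‖ ≤ √(‖y.1 - ω.1‖ ^ 2 + ‖y.2.1 - ω.2.1‖ ^ 2 + ‖y.2.2 - ω.2.2‖ ^ 2) :=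
      Real.le_sqrt_of_sq_le (by nlinarith [sq_nonneg ‖y.2.1 - ω.2.1‖, sq_nonneg ‖y.2.2 - ω.2.2‖])
    have h2 : ‖y.2.1 - ω.2.1‖ ≤
        √(‖y.1 - ω.1‖ ^ 2 + ‖y.2.1 - ω.2.1‖ ^ 2 + ‖y.2.2 - ω.2.2‖ ^ 2) :=
      Real.le_sqrt_of_sq_le (by nlinarith [sq_nonneg ‖y.1 - ω.1‖, sq_nonneg ‖y.2.2 - ω.2.2‖])
    have h3 : ‖y.2.2 - ω.2.2‖ ≤
        √(‖y.1 - ω.1‖ ^ 2 + ‖y.2.1 - ω.2.1‖ ^ 2 + ‖y.2.2 - ω.2.2‖ ^ 2) :=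
      Real.le_sqrt_of_sq_le (by nlinarith [sq_nonneg ‖y.1 - ω.1‖, sq_nonneg ‖y.2.1 - ω.2.1‖])
    nlinarith

lemma smul_mem_regNC3 {Ω : Set (X × W × Y)} {ω ζ : X × W × Y} (h : ζ ∈ regNC3 Ω ω) {c : ℝ}
    (hc : 0 < c) : c • ζ ∈ regNC3 Ω ω := by
  rw [mem_regNC3_iff] at h ⊢
  intro ε hε
  filter_upwards [h (ε / c) (by positivity)] with y hy
  simp only [Prod.smul_fst, Prod.smul_snd, real_inner_smul_left]
  calc _ = c * (⟪ζ.1, y.1 - ω.1⟫ + ⟪ζ.2.1, y.2.1 - ω.2.1⟫ + ⟪ζ.2.2, y.2.2 - ω.2.2⟫) := by ring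
    _ ≤ c * (ε / c * (‖y.1 - ω.1‖ + ‖y.2.1 - ω.2.1‖ + ‖y.2.2 - ω.2.2‖)) := by gcongr
    _ = _ := by field_simp

/-- Pointbased coderivative conditions give a uniform bound on regular normals to the graph near
the reference point. -/
lemma exists_normal_bound [FiniteDimensional ℝ X] [FiniteDimensional ℝ W]
    {g : X → W → EReal} {xb vh : X} {pb : W} {A B : X →L[ℝ] X}
    (hAB : ∀ w, ⟪B w, w⟫ = ⟪A w, w⟫)
    (ha : ∀ z : W, (0, z) ∈ limCoderivFull g xb pb vh 0 → z = 0)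
    (hb : ∀ w : X, w ≠ 0 → ∀ zs ∈ limCoderivFull g xb pb vh w, 0 < ⟪A w, w⟫ + ⟪zs.1, w⟫)
    (T₀ : ℝ) :
    ∃ ℓ > 0, ∃ ε > 0, ∀ t ∈ Icc 0 T₀, ∀ x p v, NearGph g xb pb vh ε x p v →
      ∀ z s w, (z, s, w) ∈ regNC3 (subGraph g) (x, p, v) →
        ‖s‖ + ‖w‖ ≤ ℓ * ‖z - B w - t • w‖ := by
  by_contra hcon
  push Not at hcon
  have key : ∀ k : ℕ, ∃ (t : ℝ) (ω : X × W × X) (z : X) (s : W) (w : X), t ∈ Icc 0 T₀ ∧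
      NearGph g xb pb vh (1 / ((k : ℝ) + 1)) ω.1 ω.2.1 ω.2.2 ∧
      (z, s, w) ∈ regNC3 (subGraph g) ω ∧ ‖s‖ + ‖w‖ = 1 ∧
      ‖z - B w - t • w‖ ≤ 1 / ((k : ℝ) + 1) := by
    intro k
    obtain ⟨t, ht, x, p, v, hn, z, s, w, hr, hlt⟩ := hcon ((k : ℝ) + 1) (by positivity)
      (1 / ((k : ℝ) + 1)) (by positivity)
    have hpos : 0 < ‖s‖ + ‖w‖ := lt_of_le_of_lt (by positivity) hlt
    set c := (‖s‖ + ‖w‖)⁻¹ with hc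
    have hc0 : 0 < c := inv_pos.2 hpos
    refine ⟨t, (x, p, v), c • z, c • s, c • w, ht, hn, smul_mem_regNC3 hr hc0, ?_, ?_⟩
    · rw [norm_smul, norm_smul, Real.norm_eq_abs, abs_of_pos hc0, ← mul_add, hc]
      exact inv_mul_cancel₀ hpos.ne'
    · have : c • z - B (c • w) - t • c • w = c • (z - B w - t • w) := by
        rw [map_smul, smul_sub, smul_sub, smul_comm t c]
      rw [this, norm_smul, Real.norm_eq_abs, abs_of_pos hc0, le_div_iff₀ (by positivity)]
      calc c * ‖z - B w - t • w‖ * ((k : ℝ) + 1)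
          = c * (((k : ℝ) + 1) * ‖z - B w - t • w‖) := by ring
        _ ≤ c * (‖s‖ + ‖w‖) := by gcongr
        _ = 1 := inv_mul_cancel₀ hpos.ne'
  choose t ω z s w ht hn hr hsw hzw using key
  have hcpt : IsCompact (Icc 0 T₀ ×ˢ (closedBall (0 : W) 1 ×ˢ closedBall (0 : X) 1)) :=
    isCompact_Icc.prod ((isCompact_closedBall _ _).prod (isCompact_closedBall _ _))
  obtain ⟨⟨t', s', w'⟩, hlim, φ, hφ, hconv⟩ := hcpt.tendsto_subseq
    (x := fun k => (t k, s k, w k)) fun k => by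
      refine ⟨ht k, ?_, ?_⟩
      · rw [mem_closedBall_zero_iff]; linarith [hsw k, norm_nonneg (w k)]
      · rw [mem_closedBall_zero_iff]; linarith [hsw k, norm_nonneg (s k)]
  have ht' : 0 ≤ t' := hlim.1.1
  have htt : Tendsto (fun k => t (φ k)) atTop (𝓝 t') := (continuous_fst.tendsto _).comp hconv
  have hss : Tendsto (fun k => s (φ k)) atTop (𝓝 s') :=
    ((continuous_fst.comp continuous_snd).tendsto _).comp hconv
  have hww : Tendsto (fun k => w (φ k)) atTop (𝓝 w') :=
    ((continuous_snd.comp continuous_snd).tendsto _).comp hconv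
  have hone : Tendsto (fun k : ℕ => 1 / ((k : ℝ) + 1)) atTop (𝓝 0) :=
    tendsto_one_div_add_atTop_nhds_zero_nat
  have hzz : Tendsto (fun k => z (φ k)) atTop (𝓝 (B w' + t' • w')) := by
    have h0 : Tendsto (fun k => z (φ k) - B (w (φ k)) - t (φ k) • w (φ k)) atTop (𝓝 0) :=
      squeeze_zero_norm (fun k => hzw (φ k)) (hone.comp hφ.tendsto_atTop)
    have h1 := (h0.add ((B.continuous.tendsto _).comp hww)).add (htt.smul hww)
    rw [zero_add] at h1
    refine h1.congr fun k => ?_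
    simp only [Function.comp_apply]
    abel
  have hnorm : ‖s'‖ + ‖w'‖ = 1 :=
    tendsto_nhds_unique (hss.norm.add hww.norm) (by simp only [hsw, tendsto_const_nhds])
  have hω : Tendsto ω atTop (𝓝 (xb, pb, vh)) := by
    refine Prod.tendsto_iff _ _ |>.2 ⟨?_, Prod.tendsto_iff _ _ |>.2 ⟨?_, ?_⟩⟩
    · exact tendsto_iff_norm_sub_tendsto_zero.2
        (squeeze_zero (fun _ => norm_nonneg _) (fun k => (hn k).2.1.le) hone)
    · exact tendsto_iff_dist_tendsto_zero.2
        (squeeze_zero (fun _ => dist_nonneg) (fun k => (hn k).2.2.1.le) hone)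
    · exact tendsto_iff_norm_sub_tendsto_zero.2
        (squeeze_zero (fun _ => norm_nonneg _) (fun k => (hn k).2.2.2.le) hone)
  have hlimN : (B w' + t' • w', s', w') ∈ limNC3 (subGraph g) (xb, pb, vh) :=
    ⟨ω ∘ φ, fun k => (z (φ k), s (φ k), w (φ k)), fun k => (hn (φ k)).1,
      hω.comp hφ.tendsto_atTop, fun k => hr (φ k), hzz.prodMk_nhds (hss.prodMk_nhds hww)⟩
  by_cases hw0 : w' = 0
  · subst hw0
    have h1 : (0, s') ∈ limCoderivFull g xb pb vh 0 := by
      simp only [map_zero, smul_zero, add_zero] at hlimN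
      simp only [limCoderivFull, mem_ofPred_eq, neg_zero]
      exact hlimN
    rw [ha s' h1] at hnorm
    simp at hnorm
  · have h1 : (B w' + t' • w', s') ∈ limCoderivFull g xb pb vh (-w') := by
      simp only [limCoderivFull, mem_ofPred_eq, neg_neg]
      exact hlimN
    have h2 := hb _ (neg_ne_zero.2 hw0) _ h1
    simp only [map_neg, inner_neg_left, inner_neg_right, inner_add_left, real_inner_smul_left,
      real_inner_self_eq_norm_sq, hAB] at h2
    nlinarith [mul_nonneg ht' (sq_nonneg ‖w'‖)]

/-- Fréchet subgradients of a scalarized resolvent produce regular normals to the graph of the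
partial subdifferential. -/
lemma mem_regNC3_of_resolvent_subgradient {g : X → W → EReal} {B : X →L[ℝ] X}
    (hB : ∀ a b, ⟪B a, b⟫ = ⟪a, B b⟫) {T : ℝ} {Θ : W × X → X} {p : W} {y : X}
    (huniq : ∀ᶠ ω : X × W × X in 𝓝[subGraph g] (Θ (p, y), p, y - B (Θ (p, y)) - T • Θ (p, y)),
      Θ (ω.2.1, ω.2.2 + B ω.1 + T • ω.1) = ω.1)
    {w ζv : X} {ζp : W}
    (hsub : ∀ ε > 0, ∀ᶠ z in 𝓝 (p, y), ⟪ζp, z.1 - p⟫ + ⟪ζv, z.2 - y⟫ ≤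
      ⟪w, Θ z - Θ (p, y)⟫ + ε * (‖z.1 - p‖ + ‖z.2 - y‖)) :
    (B ζv + T • ζv - w, ζp, ζv) ∈
      regNC3 (subGraph g) (Θ (p, y), p, y - B (Θ (p, y)) - T • Θ (p, y)) := by
  set x := Θ (p, y) with hx
  set v := y - B x - T • x with hv
  rw [mem_regNC3_iff]
  intro ε hε
  set C := 1 + ‖B‖ + |T| with hC
  have hC0 : 0 < C := by positivity
  have hcont : Tendsto (fun ω : X × W × X => (ω.2.1, ω.2.2 + B ω.1 + T • ω.1))
      (𝓝[subGraph g] (x, p, v)) (𝓝 (p, y)) := by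
    have h1 : Continuous fun ω : X × W × X => (ω.2.1, ω.2.2 + B ω.1 + T • ω.1) := by fun_prop
    have h2 : (p, v + B x + T • x) = (p, y) := by rw [hv]; congr 1; abel
    have h3 := h1.tendsto (x, p, v)
    simp only [h2] at h3
    exact h3.mono_left nhdsWithin_le_nhds
  filter_upwards [hcont.eventually (hsub (ε / C) (by positivity)), huniq] with ω hω hΘ
  obtain ⟨x', p', v'⟩ := ω
  simp only at hω hΘ ⊢
  rw [hΘ] at hω
  have e : v' + B x' + T • x' - y = (v' - v) + B (x' - x) + T • (x' - x) := by
    rw [hv, map_sub, smul_sub]; abel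
  rw [e] at hω
  have hn : ‖(v' - v) + B (x' - x) + T • (x' - x)‖ ≤ ‖v' - v‖ + (‖B‖ + |T|) * ‖x' - x‖ := by
    calc _ ≤ ‖v' - v‖ + ‖B (x' - x)‖ + ‖T • (x' - x)‖ := norm_add₃_le
      _ ≤ ‖v' - v‖ + ‖B‖ * ‖x' - x‖ + |T| * ‖x' - x‖ := by
        rw [norm_smul, Real.norm_eq_abs]
        gcongr
        exact B.le_opNorm _
      _ = _ := by ring
  have hb : ε / C * (‖p' - p‖ + ‖(v' - v) + B (x' - x) + T • (x' - x)‖)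
      ≤ ε * (‖x' - x‖ + ‖p' - p‖ + ‖v' - v‖) := by
    have : ‖p' - p‖ + ‖(v' - v) + B (x' - x) + T • (x' - x)‖ ≤
        C * (‖x' - x‖ + ‖p' - p‖ + ‖v' - v‖) := by
      have h1 : 0 ≤ (‖B‖ + |T|) * (‖p' - p‖ + ‖v' - v‖) := by positivity
      have h2 := norm_nonneg (x' - x)
      rw [hC]; linarith
    calc _ ≤ ε / C * (C * (‖x' - x‖ + ‖p' - p‖ + ‖v' - v‖)) := by gcongr
      _ = _ := by field_simp
  have hBs := hB ζv (x' - x)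
  simp only [inner_add_right, real_inner_smul_right, inner_sub_left (B ζv + T • ζv),
    inner_add_left, real_inner_smul_left] at hω ⊢
  linarith

/-- Under a uniform bound on regular normals, the resolvent map is Lipschitz continuous jointly
in the parameter and the canonical perturbation. -/
lemma exists_lipschitz_resolvent [FiniteDimensional ℝ X] [FiniteDimensional ℝ W]
    {g : X → W → EReal} (hlsc : LowerSemicontinuous fun t : X × W => g t.1 t.2)
    (hproper : ∀ x p, g x p ≠ ⊥) {B : X →L[ℝ] X} (hB : ∀ a b, ⟪B a, b⟫ = ⟪a, B b⟫)
    {xb vh : X} {pb : W} {t T ε ε' ℓ : ℝ} (hmem : vh ∈ pSubdiff g xb pb)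
    (hq : QuadMinorant g xb pb vh B t ε)
    (hin : InnerReg g xb pb vh ε) (hT : t < T) (hε' : ε' ≤ ε) (hε0 : 0 < ε') (hℓ : 0 ≤ ℓ)
    (hN : ∀ x p v, NearGph g xb pb vh ε' x p v → ∀ z s w,
      (z, s, w) ∈ regNC3 (subGraph g) (x, p, v) → ‖s‖ + ‖w‖ ≤ ℓ * ‖z - B w - T • w‖) :
    ∃ η > 0, ∃ Θ : W × X → X, ContinuousOn Θ (ball (pb, vh + B xb + T • xb) η) ∧
      (∀ z ∈ ball (pb, vh + B xb + T • xb) η,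
        NearGph g xb pb vh ε' (Θ z) z.1 (z.2 - B (Θ z) - T • Θ z)) ∧
      ∀ a ∈ ball (pb, vh + B xb + T • xb) η, ∀ b ∈ ball (pb, vh + B xb + T • xb) η,
        ‖Θ a - Θ b‖ ≤ (ℓ + 2) * (‖a.1 - b.1‖ + ‖a.2 - b.2‖) := by
  obtain ⟨η, hη, Θ, hΘc, hΘ⟩ := exists_resolvent hlsc hproper hB hmem hq hin hT hε' hε0
  set yb := vh + B xb + T • xb with hyb
  set zb : WithLp 2 (W × X) := WithLp.toLp 2 (pb, yb) with hzb
  have hle : ∀ z z' : WithLp 2 (W × X), dist z.ofLp z'.ofLp ≤ dist z z' := by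
    intro z z'
    rw [dist_eq_norm z z', WithLp.prod_norm_eq_of_L2, Prod.dist_eq, dist_eq_norm, dist_eq_norm]
    refine max_le ?_ ?_ <;> refine Real.le_sqrt_of_sq_le ?_
    · exact le_add_of_nonneg_right (sq_nonneg _)
    · exact le_add_of_nonneg_left (sq_nonneg _)
  have hnle : ∀ z z' : WithLp 2 (W × X), ‖z - z'‖ ≤ ‖z.fst - z'.fst‖ + ‖z.snd - z'.snd‖ := by
    intro z z'
    rw [WithLp.prod_norm_eq_of_L2]
    refine Real.sqrt_le_iff.2 ⟨by positivity, ?_⟩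
    simp only [WithLp.sub_fst, WithLp.sub_snd]
    nlinarith [mul_nonneg (norm_nonneg (z.fst - z'.fst)) (norm_nonneg (z.snd - z'.snd))]
  have hmaps : MapsTo (fun z : WithLp 2 (W × X) => z.ofLp) (ball zb η) (ball (pb, yb) η) :=
    fun z hz => lt_of_le_of_lt (hle z zb) hz
  have hFc : ContinuousOn (fun z : WithLp 2 (W × X) => Θ z.ofLp) (ball zb η) :=
    hΘc.comp (WithLp.prod_continuous_ofLp 2 _ _).continuousOn hmaps
  obtain ⟨ρ, hρ, hlip⟩ := lipschitz_of_subgradient_bound (ℓ := ℓ) hη hℓ hFc (by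
    intro z hz w ζ hζ
    have hz' := hmaps hz
    have hnear := hΘ _ hz'
    have huniq : ∀ᶠ ω : X × W × X in 𝓝[subGraph g] (Θ (z.fst, z.snd), z.fst,
        z.snd - B (Θ (z.fst, z.snd)) - T • Θ (z.fst, z.snd)),
        Θ (ω.2.1, ω.2.2 + B ω.1 + T • ω.1) = ω.1 := by
      have hev : ∀ᶠ ω : X × W × X in 𝓝[subGraph g] (Θ (z.fst, z.snd), z.fst,
          z.snd - B (Θ (z.fst, z.snd)) - T • Θ (z.fst, z.snd)),
          ‖ω.1 - xb‖ < ε' ∧ dist ω.2.1 pb < ε' ∧ ‖ω.2.2 - vh‖ < ε' ∧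
          (ω.2.1, ω.2.2 + B ω.1 + T • ω.1) ∈ ball (pb, yb) η := by
        refine nhdsWithin_le_nhds ?_
        have o1 : IsOpen {ω : X × W × X | ‖ω.1 - xb‖ < ε' ∧ dist ω.2.1 pb < ε' ∧
            ‖ω.2.2 - vh‖ < ε' ∧ (ω.2.1, ω.2.2 + B ω.1 + T • ω.1) ∈ ball (pb, yb) η} := by
          have c1 : Continuous fun ω : X × W × X => ‖ω.1 - xb‖ := by fun_prop
          have c2 : Continuous fun ω : X × W × X => dist ω.2.1 pb := by fun_prop
          have c3 : Continuous fun ω : X × W × X => ‖ω.2.2 - vh‖ := by fun_prop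
          have c4 : Continuous fun ω : X × W × X => (ω.2.1, ω.2.2 + B ω.1 + T • ω.1) := by
            fun_prop
          exact (isOpen_lt c1 continuous_const).inter ((isOpen_lt c2 continuous_const).inter
            ((isOpen_lt c3 continuous_const).inter (isOpen_ball.preimage c4)))
        refine o1.mem_nhds ⟨hnear.2.1, hnear.2.2.1, hnear.2.2.2, ?_⟩
        have e : z.snd - B (Θ (z.fst, z.snd)) - T • Θ (z.fst, z.snd) + B (Θ (z.fst, z.snd))
            + T • Θ (z.fst, z.snd) = z.snd := by abel
        simp only [e]
        exact hz'
      filter_upwards [hev, self_mem_nhdsWithin] with ω hω hωG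
      have hn1 : NearGph g xb pb vh ε' ω.1 ω.2.1 ω.2.2 := ⟨hωG, hω.1, hω.2.1, hω.2.2.1⟩
      refine hq.eq_of_eq hin hT ((hΘ _ hω.2.2.2).mono hε') (hn1.mono hε') ?_
      abel_nf
    have hsub : ∀ ε > 0, ∀ᶠ y in 𝓝 (z.fst, z.snd), ⟪ζ.fst, y.1 - z.fst⟫ + ⟪ζ.snd, y.2 - z.snd⟫ ≤
        ⟪w, Θ y - Θ (z.fst, z.snd)⟫ + ε * (‖y.1 - z.fst‖ + ‖y.2 - z.snd‖) := by
      intro ε hε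
      have hc : Tendsto (fun y : W × X => WithLp.toLp 2 y) (𝓝 (z.fst, z.snd)) (𝓝 z) :=
        (WithLp.prod_continuous_toLp 2 W X).tendsto (z.fst, z.snd)
      filter_upwards [hc.eventually (hζ ε hε)] with y hy
      rw [WithLp.prod_inner_apply] at hy
      exact hy.trans (add_le_add_right (mul_le_mul_of_nonneg_left (hnle _ _) hε.le) _)
    have := hN _ _ _ hnear _ _ _ (mem_regNC3_of_resolvent_subgradient hB huniq hsub)
    have e : B ζ.snd + T • ζ.snd - w - B ζ.snd - T • ζ.snd = -w := by abel
    rw [e, norm_neg] at this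
    have h0 := hnle ζ 0
    simp only [sub_zero, WithLp.zero_fst, WithLp.zero_snd] at h0
    exact h0.trans this)
  have hsmall : ∀ a ∈ ball (pb, yb) (min η (ρ / 2)), WithLp.toLp 2 a ∈ ball zb ρ := by
    intro a ha
    have h1 : dist a (pb, yb) < ρ / 2 := ha.trans_le (min_le_right _ _)
    rw [Prod.dist_eq, max_lt_iff, dist_eq_norm, dist_eq_norm] at h1
    rw [mem_ball, dist_eq_norm]
    refine (hnle _ _).trans_lt ?_
    have := add_lt_add h1.1 h1.2
    rw [add_halves] at this
    exact this
  refine ⟨min η (ρ / 2), by positivity, Θ, hΘc.mono (ball_subset_ball (min_le_left _ _)),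
    fun z hz => hΘ z (ball_subset_ball (min_le_left _ _) hz), fun a ha b hb => ?_⟩
  refine (hlip _ (hsmall a ha) _ (hsmall b hb)).trans ?_
  gcongr
  exact hnle _ _

/-- A Lipschitz modulus of the resolvent improves the constant in the quadratic minorant. -/
lemma QuadMinorant.improve [FiniteDimensional ℝ X] [FiniteDimensional ℝ W]
    {g : X → W → EReal} (hlsc : LowerSemicontinuous fun t : X × W => g t.1 t.2)
    (hproper : ∀ x p, g x p ≠ ⊥) {B : X →L[ℝ] X} (hB : ∀ a b, ⟪B a, b⟫ = ⟪a, B b⟫)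
    {xb vh : X} {pb : W} {t T ε ℓ : ℝ} (hmem : vh ∈ pSubdiff g xb pb)
    (hq : QuadMinorant g xb pb vh B t ε)
    (hin : InnerReg g xb pb vh ε) (hε0 : 0 < ε) (hℓ : 0 ≤ ℓ)
    (hT : T = t + 1 / (4 * (ℓ + 2)))
    (hN : ∀ x p v, NearGph g xb pb vh ε x p v → ∀ z s w,
      (z, s, w) ∈ regNC3 (subGraph g) (x, p, v) → ‖s‖ + ‖w‖ ≤ ℓ * ‖z - B w - T • w‖) :
    ∃ ε' > 0, QuadMinorant g xb pb vh B (t - 1 / (4 * (ℓ + 2))) ε' := by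
  have htT : t < T := by
    have : 0 < 1 / (4 * (ℓ + 2)) := by positivity
    linarith
  obtain ⟨η, hη, Θ, -, hΘ, hlip⟩ := exists_lipschitz_resolvent hlsc hproper hB hmem hq hin htT
    le_rfl hε0 hℓ hN
  set M := ℓ + 2 with hM
  have hM0 : 0 < M := by positivity
  set τ := 1 / (2 * M) with hτ
  have hτ0 : 0 < τ := by positivity
  set C := 1 + ‖B‖ + |T| + 2 * τ with hC
  have hC1 : 1 ≤ C := by
    have : 0 ≤ ‖B‖ + |T| + 2 * τ := by positivity
    rw [hC]; linarith
  set ε' := min ε (η / C) with hε'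
  have hε'0 : 0 < ε' := by positivity
  have hCη : C * ε' ≤ η := by
    calc C * ε' ≤ C * (η / C) := by gcongr; exact min_le_right _ _
      _ = η := by field_simp
  have hε'η : ε' ≤ η := by nlinarith
  refine ⟨ε', hε'0, fun u p v hu x hx => ?_⟩
  have huε := hu.mono (min_le_left _ _ : ε' ≤ ε)
  set y₁ := v + B u + T • u with hy₁
  have hy₁n : ‖y₁ - (vh + B xb + T • xb)‖ ≤ (1 + ‖B‖ + |T|) * ε' := by
    have e : y₁ - (vh + B xb + T • xb) = (v - vh) + B (u - xb) + T • (u - xb) := by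
      rw [hy₁, map_sub, smul_sub]; abel
    rw [e]
    calc _ ≤ ‖v - vh‖ + ‖B (u - xb)‖ + ‖T • (u - xb)‖ := norm_add₃_le
      _ ≤ ε' + ‖B‖ * ε' + |T| * ε' := by
        rw [norm_smul, Real.norm_eq_abs]
        gcongr
        · exact hu.2.2.2.le
        · exact (B.le_opNorm _).trans (by gcongr; exact hu.2.1.le)
        · exact hu.2.1.le
      _ = _ := by ring
  have hxu : ‖x - u‖ < 2 * ε' := by
    have := norm_sub_le_norm_sub_add_norm_sub x xb u
    rw [norm_sub_rev xb u] at this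
    linarith [hu.2.1]
  have hmem₁ : (p, y₁) ∈ ball (pb, vh + B xb + T • xb) η := by
    rw [mem_ball, Prod.dist_eq, max_lt_iff, dist_eq_norm y₁]
    refine ⟨hu.2.2.1.trans_le hε'η, hy₁n.trans_lt (lt_of_lt_of_le ?_ hCη)⟩
    gcongr
    rw [hC]; linarith
  have hmem₂ : (p, y₁ + τ • (x - u)) ∈ ball (pb, vh + B xb + T • xb) η := by
    rw [mem_ball, Prod.dist_eq, max_lt_iff, dist_eq_norm (y₁ + τ • (x - u))]
    refine ⟨hu.2.2.1.trans_le hε'η, ?_⟩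
    rw [add_sub_right_comm]
    refine (norm_add_le _ _).trans_lt (lt_of_lt_of_le ?_ hCη)
    rw [norm_smul, Real.norm_eq_abs, abs_of_pos hτ0, hC]
    have := mul_lt_mul_of_pos_left hxu hτ0
    linarith
  have hΘ₁ : Θ (p, y₁) = u := by
    refine hq.eq_of_eq hin htT (hΘ _ hmem₁) huε ?_
    simp only [hy₁]
    abel
  set y := Θ (p, y₁ + τ • (x - u)) with hy
  have hny := hΘ _ hmem₂
  have hyu : ‖y - u‖ ≤ 1 / 2 * ‖x - u‖ := by
    have := hlip _ hmem₂ _ hmem₁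
    rw [hΘ₁] at this
    simp only [sub_self, norm_zero, zero_add, add_sub_cancel_left, norm_smul, Real.norm_eq_abs,
      abs_of_pos hτ0] at this
    calc ‖y - u‖ ≤ M * (τ * ‖x - u‖) := this
      _ = _ := by rw [hτ]; field_simp
  have hqT := hq.mono htT.le le_rfl
  have i₁ := hqT u p v huε y hny.2.1
  have i₂ := hqT _ _ _ hny x (hx.trans_le (min_le_left _ _))
  simp only [← hy] at i₂
  have chain := (add_le_add_left i₁ _).trans i₂
  rw [add_assoc, ← EReal.coe_add] at chain
  refine le_trans ?_ chain
  gcongr _ + ((?_ : ℝ) : EReal)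
  set a := y - u with ha
  set b := x - y with hb
  have hd : x - u = a + b := by rw [ha, hb]; abel
  rw [hd] at hyu ⊢
  have hvy : y₁ + τ • (a + b) - B y - T • y = v + τ • (a + b) - B a - T • a := by
    rw [hy₁, ha, map_sub, smul_sub]; abel
  rw [hvy]
  have hab : ⟪a + b, a⟫ ≤ 1 / 2 * ‖a + b‖ ^ 2 := by
    calc ⟪a + b, a⟫ ≤ ‖a + b‖ * ‖a‖ := real_inner_le_norm _ _
      _ ≤ ‖a + b‖ * (1 / 2 * ‖a + b‖) := by gcongr
      _ = _ := by ring
  have hnn : ‖a + b‖ ^ 2 = ‖a‖ ^ 2 + 2 * ⟪a, b⟫ + ‖b‖ ^ 2 := norm_add_sq_real a b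
  have hσ : 1 / (4 * M) = τ / 2 := by rw [hτ]; field_simp; norm_num
  rw [hσ] at hT ⊢
  have hBs : ⟪B b, a⟫ = ⟪B a, b⟫ := by rw [hB, real_inner_comm]
  have hcomm : ⟪b, a⟫ = ⟪a, b⟫ := real_inner_comm a b
  simp only [map_add, inner_add_left, inner_add_right, inner_sub_left, real_inner_smul_left,
    real_inner_self_eq_norm_sq, hcomm, hBs] at hab ⊢
  have h1 := mul_le_mul_of_nonneg_left hab hτ0.le
  rw [hnn] at h1 ⊢
  rw [show t = T - τ / 2 by linarith]
  linarith

/-- The pointbased coderivative conditions yield the quadratic minorant with a negative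
correction, i.e. uniform strong convexity-like behaviour of `g + ½⟪B ·, ·⟫`. -/
lemma exists_quadMinorant_neg [FiniteDimensional ℝ X] [FiniteDimensional ℝ W]
    {g : X → W → EReal} (hlsc : LowerSemicontinuous fun t : X × W => g t.1 t.2)
    (hproper : ∀ x p, g x p ≠ ⊥) {A B : X →L[ℝ] X} (hB : ∀ a b, ⟪B a, b⟫ = ⟪a, B b⟫)
    (hAB : ∀ w, ⟪B w, w⟫ = ⟪A w, w⟫) {xb vh : X} {pb : W} (hmem : vh ∈ pSubdiff g xb pb)
    (hA2 : A2 g xb pb vh) (hA3 : A3 g xb pb)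
    (ha : ∀ z : W, (0, z) ∈ limCoderivFull g xb pb vh 0 → z = 0)
    (hb : ∀ w : X, w ≠ 0 → ∀ zs ∈ limCoderivFull g xb pb vh w, 0 < ⟪A w, w⟫ + ⟪zs.1, w⟫) :
    ∃ c > 0, ∃ ε > 0, QuadMinorant g xb pb vh B (-c) ε := by
  obtain ⟨ε₁, hε₁, hin⟩ := exists_innerReg hproper hmem hA2 hA3
  obtain ⟨r, hr, hprox⟩ := hA2.1
  set t₀ := r + ‖B‖ with ht₀
  have ht₀0 : 0 ≤ t₀ := by positivity
  obtain ⟨ℓ, hℓ, ε₂, hε₂, hN⟩ := exists_normal_bound hAB ha hb (t₀ + 1)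
  set δ := 1 / (4 * (ℓ + 2)) with hδ
  have hδ0 : 0 < δ := by positivity
  have hδ1 : δ ≤ 1 := by
    rw [hδ, div_le_one (by positivity)]; linarith
  have step : ∀ t, 0 ≤ t → t ≤ t₀ → (∃ ε > 0, QuadMinorant g xb pb vh B t ε) →
      ∃ ε > 0, QuadMinorant g xb pb vh B (t - δ) ε := by
    rintro t h0 h1 ⟨ε, hε, hq⟩
    exact (hq.mono le_rfl (min_le_left ε (min ε₁ ε₂))).improve hlsc hproper hB hmem
      (hin.mono ((min_le_right _ _).trans (min_le_left _ _))) (by positivity) hℓ.le rfl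
      fun x p v hn => hN (t + δ) ⟨by positivity, by linarith⟩ x p v
        (hn.mono ((min_le_right _ _).trans (min_le_right _ _)))
  have iter : ∀ n : ℕ, ∃ ε > 0, QuadMinorant g xb pb vh B (max (t₀ - n * δ) 0) ε := by
    intro n
    induction n with
    | zero =>
      obtain ⟨ε, hε, hq⟩ := QuadMinorant.of_proxRegWith hprox B
      exact ⟨ε, hε, hq.mono (by simp [ht₀]) le_rfl⟩
    | succ n ih =>
      obtain ⟨ε, hε, hq⟩ := step _ (le_max_right _ _)
        (max_le (sub_le_self _ (by positivity)) ht₀0) ih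
      refine ⟨ε, hε, hq.mono ?_ le_rfl⟩
      rw [sub_le_iff_le_add]
      refine max_le ?_ (add_nonneg (le_max_right _ _) hδ0.le)
      have := le_max_left (t₀ - ((n + 1 : ℕ) : ℝ) * δ) 0
      push_cast at this ⊢
      linarith
  obtain ⟨n, hn⟩ := exists_nat_ge (t₀ / δ)
  have hn' : t₀ - n * δ ≤ 0 := by
    rw [div_le_iff₀ hδ0] at hn; linarith
  obtain ⟨ε, hε, hq⟩ := step 0 le_rfl ht₀0 (by simpa [max_eq_right hn'] using iter n)
  exact ⟨δ, hδ0, ε, hε, by simpa using hq⟩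

lemma A1.continuousAt {E : Type*} [NormedAddCommGroup E] {f : E → P → Q → E} {xb : E}
    {pb : P} {qb : Q} (h : A1 f xb pb qb) :
    ContinuousAt (fun t : E × P × Q => f t.1 t.2.1 t.2.2) (xb, pb, qb) := by
  obtain ⟨L, hL, ε, hε, h⟩ := h
  rw [ContinuousAt, tendsto_iff_norm_sub_tendsto_zero]
  have hc : Continuous fun t : E × P × Q => L * (‖t.1 - xb‖ + dist t.2.1 pb + dist t.2.2 qb) := by
    fun_prop
  have h0 := hc.tendsto (xb, pb, qb)
  simp only [sub_self, norm_zero, dist_self, add_zero, mul_zero] at h0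
  refine squeeze_zero' (Eventually.of_forall fun _ => norm_nonneg _) ?_ h0
  filter_upwards [ball_mem_nhds (xb, pb, qb) hε] with t ht
  rw [mem_ball, Prod.dist_eq, Prod.dist_eq, max_lt_iff, max_lt_iff, dist_eq_norm] at ht
  exact h _ _ _ _ _ _ ht.1 (by simpa) ht.2.1 (by simpa) ht.2.2 (by simpa)

lemma A4.strict_approx {f : X → P → Q → X} {Df : X → P → Q → X →L[ℝ] X} {xb : X} {pb : P}
    {qb : Q} (h : A4 f Df xb pb qb) {e : ℝ} (he : 0 < e) :
    ∃ ρ > 0, ∀ x₁ x₂ p q, ‖x₁ - xb‖ < ρ → ‖x₂ - xb‖ < ρ → dist p pb < ρ → dist q qb < ρ →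
      ‖f x₁ p q - f x₂ p q - Df xb pb qb (x₁ - x₂)‖ ≤ e * ‖x₁ - x₂‖ := by
  obtain ⟨⟨η, hη, hunif⟩, hcont⟩ := h
  obtain ⟨δ, hδ, hd⟩ := hunif (e / 2) (by positivity)
  obtain ⟨r, hr, hD⟩ := Metric.tendsto_nhds_nhds.1 hcont (e / 2) (by positivity)
  refine ⟨min (min η r) (δ / 2), by positivity, fun x₁ x₂ p q h₁ h₂ hp hq => ?_⟩
  simp only [lt_min_iff] at h₁ h₂ hp hq
  have hx : ‖x₁ - x₂‖ < δ := by
    have := norm_sub_le_norm_sub_add_norm_sub x₁ xb x₂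
    rw [norm_sub_rev xb x₂] at this
    linarith
  have e1 := hd x₂ p q h₂.1.1 hp.1.1 hq.1.1 x₁ hx
  have e2 : dist (Df x₂ p q) (Df xb pb qb) < e / 2 := by
    refine @hD (x₂, p, q) ?_
    rw [Prod.dist_eq, Prod.dist_eq, max_lt_iff, max_lt_iff, dist_eq_norm]
    exact ⟨h₂.1.2, hp.1.2, hq.1.2⟩
  rw [dist_eq_norm] at e2
  have e3 := (Df x₂ p q - Df xb pb qb).le_opNorm (x₁ - x₂)
  calc _ = ‖(f x₁ p q - f x₂ p q - Df x₂ p q (x₁ - x₂)) +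
        (Df x₂ p q - Df xb pb qb) (x₁ - x₂)‖ := by congr 1; simp
    _ ≤ e / 2 * ‖x₁ - x₂‖ + e / 2 * ‖x₁ - x₂‖ :=
      (norm_add_le _ _).trans (add_le_add e1 (e3.trans (by gcongr)))
    _ = _ := by ring

lemma exists_fixedPoint_of_contraction {α : Type*} [MetricSpace α] {K : Set α} (hK : IsCompact K)
    (hne : K.Nonempty) {Φ : α → α} (hmaps : MapsTo Φ K K) {θ : ℝ} (hθ : θ < 1)
    (hΦ : ∀ x ∈ K, ∀ y ∈ K, dist (Φ x) (Φ y) ≤ θ * dist x y) : ∃ x ∈ K, Φ x = x := by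
  have hc : ContinuousOn Φ K := by
    refine (LipschitzOnWith.of_dist_le_mul (K := θ.toNNReal) fun x hx y hy => ?_).continuousOn
    exact (hΦ x hx y hy).trans (by gcongr; exact Real.le_coe_toNNReal θ)
  obtain ⟨x, hx, hmin⟩ := hK.exists_isMinOn hne
    (continuous_dist.comp_continuousOn (hc.prodMk continuousOn_id))
  refine ⟨x, hx, ?_⟩
  by_contra hne'
  have h0 : 0 < dist (Φ x) x := dist_pos.2 hne'
  have h1 : dist (Φ x) x ≤ dist (Φ (Φ x)) (Φ x) := hmin (hmaps hx)
  have h2 := hΦ _ (hmaps hx) _ hx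
  nlinarith

/-- Local solvability of the variational system under the strengthened quadratic minorant. -/
lemma exists_local_solution [FiniteDimensional ℝ X] [FiniteDimensional ℝ W]
    {g : X → W → EReal} (hlsc : LowerSemicontinuous fun t : X × W => g t.1 t.2)
    (hproper : ∀ x p, g x p ≠ ⊥) {A B : X →L[ℝ] X} (hB : ∀ a b, ⟪B a, b⟫ = ⟪a, B b⟫)
    (hAB : ∀ w, ⟪B w, w⟫ = ⟪A w, w⟫) {f : X → W → Q → X}
    {xb vh vb : X} {pb : W} {qb : Q} (hmem : vh ∈ pSubdiff g xb pb) (hvh : vh = vb - f xb pb qb)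
    {c ε ρ₀ ρ : ℝ} (hc : 0 < c) (hε : 0 < ε)
    (hq : QuadMinorant g xb pb vh B (-c) ε) (hin : InnerReg g xb pb vh ε)
    (hA1 : A1 f xb pb qb) (hρ₀ : 0 < ρ₀)
    (hf : ∀ x₁ x₂ p q, ‖x₁ - xb‖ < ρ₀ → ‖x₂ - xb‖ < ρ₀ → dist p pb < ρ₀ → dist q qb < ρ₀ →
      ‖f x₁ p q - f x₂ p q - A (x₁ - x₂)‖ ≤ c / 4 * ‖x₁ - x₂‖) (hρ : 0 < ρ) :
    ∃ ν > 0, ∀ v p q, ‖v - vb‖ < ν → dist p pb < ν → dist q qb < ν →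
      ∃ x, ‖x - xb‖ ≤ ρ ∧ v - f x p q ∈ pSubdiff g x p := by
  set a := ‖A - B‖ with ha
  set T := a ^ 2 / c with hT
  have hT0 : 0 ≤ T := by positivity
  have hTc : a ^ 2 = T * c := by rw [hT]; field_simp
  have hcT : -c < T := by linarith
  obtain ⟨η, hη, Θ, hΘc, hΘ⟩ := exists_resolvent hlsc hproper hB hmem hq hin hcT le_rfl hε
  set yb := vh + B xb + T • xb with hyb
  set θ := (T + 3 * c / 4) / (T + c) with hθ
  have hTc0 : 0 < T + c := by linarith
  have hθ1 : θ < 1 := by rw [hθ, div_lt_one hTc0]; linarith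
  have hΘb : Θ (pb, yb) = xb := by
    have h1 := hΘ _ (mem_ball_self hη)
    refine hq.eq_of_eq hin hcT h1 ⟨hmem, by simpa, by simpa, by simpa⟩ ?_
    simp only [hyb]
    abel
  set Y : X → X → W → Q → W × X := fun x v p q => (p, v - f x p q + B x + T • x) with hY
  have hYc : ContinuousAt (fun s : X × X × W × Q => Y s.1 s.2.1 s.2.2.1 s.2.2.2)
      (xb, vb, pb, qb) := by
    have hfc : ContinuousAt (fun s : X × X × W × Q => f s.1 s.2.2.1 s.2.2.2) (xb, vb, pb, qb) :=
      ContinuousAt.comp (f := fun s : X × X × W × Q => (s.1, s.2.2.1, s.2.2.2))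
        (g := fun t : X × W × Q => f t.1 t.2.1 t.2.2) hA1.continuousAt (by fun_prop)
    have h1 : ContinuousAt (fun s : X × X × W × Q => s.2.1) (xb, vb, pb, qb) := by fun_prop
    exact ContinuousAt.prodMk (by fun_prop) (((h1.sub hfc).add (by fun_prop)).add (by fun_prop))
  have hYb : Y xb vb pb qb = (pb, yb) := by simp only [hY, hyb, hvh]
  have hev₁ : ∀ᶠ s : X × X × W × Q in 𝓝 (xb, vb, pb, qb),
      Y s.1 s.2.1 s.2.2.1 s.2.2.2 ∈ ball (pb, yb) η := by
    refine hYc.eventually ?_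
    simp only [hYb]
    exact ball_mem_nhds _ hη
  obtain ⟨δ₁, hδ₁, hball₁⟩ := Metric.eventually_nhds_iff.1 hev₁
  set ρ' := min (min ρ (δ₁ / 2)) (ρ₀ / 2) with hρ'
  have hρ'0 : 0 < ρ' := by positivity
  have hev₂ : ∀ᶠ s : X × X × W × Q in 𝓝 (xb, vb, pb, qb),
      Θ (Y s.1 s.2.1 s.2.2.1 s.2.2.2) ∈ ball xb ((1 - θ) * ρ') := by
    have h1 : ContinuousAt Θ (pb, yb) := hΘc.continuousAt (ball_mem_nhds _ hη)
    rw [← hYb] at h1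
    have h2 : ContinuousAt (fun s : X × X × W × Q => Θ (Y s.1 s.2.1 s.2.2.1 s.2.2.2))
      (xb, vb, pb, qb) := ContinuousAt.comp (g := Θ) h1 hYc
    refine h2.eventually ?_
    simp only [hYb, hΘb]
    exact ball_mem_nhds _ (mul_pos (by linarith) hρ'0)
  obtain ⟨δ₂, hδ₂, hball₂⟩ := Metric.eventually_nhds_iff.1 hev₂
  refine ⟨min (min δ₁ δ₂) ρ₀, by positivity, fun v p q hv hp hq' => ?_⟩
  simp only [lt_min_iff] at hv hp hq'
  have hYmem : ∀ x ∈ closedBall xb ρ', Y x v p q ∈ ball (pb, yb) η := by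
    intro x hx
    refine @hball₁ (x, v, p, q) ?_
    rw [Prod.dist_eq, Prod.dist_eq, Prod.dist_eq, max_lt_iff, max_lt_iff, max_lt_iff,
      dist_eq_norm v]
    refine ⟨lt_of_le_of_lt hx ?_, hv.1.1, hp.1.1, hq'.1.1⟩
    have : ρ' ≤ δ₁ / 2 := (min_le_left _ _).trans (min_le_right _ _)
    linarith
  have hstart : dist (Θ (Y xb v p q)) xb < (1 - θ) * ρ' := by
    refine @hball₂ (xb, v, p, q) ?_
    rw [Prod.dist_eq, Prod.dist_eq, Prod.dist_eq, max_lt_iff, max_lt_iff, max_lt_iff,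
      dist_eq_norm v, dist_self]
    exact ⟨hδ₂, hv.1.2, hp.1.2, hq'.1.2⟩
  have hcontr : ∀ x ∈ closedBall xb ρ', ∀ x' ∈ closedBall xb ρ',
      dist (Θ (Y x v p q)) (Θ (Y x' v p q)) ≤ θ * dist x x' := by
    intro x hx x' hx'
    have hxρ : ∀ x ∈ closedBall xb ρ', ‖x - xb‖ < ρ₀ := by
      intro x hx
      rw [mem_closedBall, dist_eq_norm] at hx
      have : ρ' ≤ ρ₀ / 2 := min_le_right _ _
      linarith
    have e1 := hf x x' p q (hxρ x hx) (hxρ x' hx') hp.2 hq'.2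
    have e2 := hq.le_inner hin T (p := p) (x₁ := Θ (Y x v p q)) (x₂ := Θ (Y x' v p q))
      (hΘ _ (hYmem x hx)) (hΘ _ (hYmem x' hx'))
    set z := Θ (Y x v p q)
    set z' := Θ (Y x' v p q)
    set Δ := x - x' with hΔ
    have e3 : (Y x v p q).2 - B z - T • z + B z + T • z - ((Y x' v p q).2 - B z' - T • z' + B z' +
        T • z') = (T • Δ - (A - B) Δ) - (f x p q - f x' p q - A Δ) := by
      simp only [hY, hΔ, sub_apply, map_sub, smul_sub]
      abel
    rw [e3] at e2
    have hanti : ⟪(A - B) Δ, Δ⟫ = 0 := by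
      rw [sub_apply, inner_sub_left, hAB, sub_self]
    have e4 : ‖T • Δ - (A - B) Δ‖ ≤ (T + c / 2) * ‖Δ‖ := by
      refine abs_le_of_sq_le_sq' ?_ (by positivity) |>.2
      have h1 := norm_sub_sq_real (T • Δ) ((A - B) Δ)
      rw [real_inner_smul_left, real_inner_comm, hanti, norm_smul, Real.norm_eq_abs, mul_pow,
        sq_abs] at h1
      have h2 : ‖(A - B) Δ‖ ^ 2 ≤ (a * ‖Δ‖) ^ 2 := by
        gcongr; exact (A - B).le_opNorm Δ
      have h3 : 0 ≤ c ^ 2 * ‖Δ‖ ^ 2 := by positivity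
      rw [mul_pow, hTc] at h2
      rw [h1]
      nlinarith
    have e5 : ‖(T • Δ - (A - B) Δ) - (f x p q - f x' p q - A Δ)‖ ≤ (T + 3 * c / 4) * ‖Δ‖ := by
      refine (norm_sub_le _ _).trans ?_
      linarith
    have e6 := e2.trans ((real_inner_le_norm _ _).trans
      (mul_le_mul_of_nonneg_right e5 (norm_nonneg (z - z'))))
    rw [dist_eq_norm, dist_eq_norm, hθ, div_mul_eq_mul_div, le_div_iff₀ hTc0]
    rcases (norm_nonneg (z - z')).eq_or_lt with h0 | h0
    · rw [← h0, zero_mul]; positivity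
    · refine le_of_mul_le_mul_right ?_ h0
      linarith
  have hmaps : MapsTo (fun x => Θ (Y x v p q)) (closedBall xb ρ') (closedBall xb ρ') := by
    intro x hx
    have h1 := hcontr x hx xb (mem_closedBall_self hρ'0.le)
    have h2 := dist_triangle (Θ (Y x v p q)) (Θ (Y xb v p q)) xb
    have h3 : θ * dist x xb ≤ θ * ρ' := by
      gcongr; exact hx
    rw [mem_closedBall]
    linarith
  obtain ⟨x, hx, hfix⟩ := exists_fixedPoint_of_contraction (isCompact_closedBall xb ρ')
    (nonempty_closedBall.2 hρ'0.le) hmaps hθ1 hcontr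
  refine ⟨x, ?_, ?_⟩
  · rw [mem_closedBall, dist_eq_norm] at hx
    exact hx.trans ((min_le_left _ _).trans (min_le_left _ _))
  · have h1 := (hΘ _ (hYmem x hx)).1
    rw [hfix] at h1
    convert h1 using 1
    simp only [hY]
    abel

/-- The full stability estimate for two solutions, given an intermediate resolvent point. -/
lemma QuadMinorant.stability_estimate {g : X → P → EReal} {A B : X →L[ℝ] X}
    (hAB : ∀ w, ⟪B w, w⟫ = ⟪A w, w⟫) {f : X → P → Q → X} {xb vh : X} {pb : P}
    {c ε ℓ L : ℝ} (hc : 0 < c) (hℓ : 0 ≤ ℓ) (hL : 0 ≤ L) (hq : QuadMinorant g xb pb vh B (-c) ε)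
    (hin : InnerReg g xb pb vh ε) {x₁ x₂ x v₁ v₂ : X} {p₁ p₂ : P} {q₁ q₂ : Q}
    (hx : NearGph g xb pb vh ε x p₂ (v₁ - f x₁ p₁ q₁ + B x₁ - B x))
    (hx₂ : NearGph g xb pb vh ε x₂ p₂ (v₂ - f x₂ p₂ q₂))
    (hxx : ‖x - x₁‖ ≤ ℓ * dist p₁ p₂)
    (hLip : ‖f x₁ p₁ q₁ - f x p₂ q₂‖ ≤ L * (‖x₁ - x‖ + dist p₁ p₂ + dist q₁ q₂))
    (hs : ‖f x p₂ q₂ - f x₂ p₂ q₂ - A (x - x₂)‖ ≤ c / 4 * ‖x - x₂‖) :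
    ‖(v₁ - v₂) - (2 * (c / 2)) • (x₁ - x₂)‖ ≤ ‖v₁ - v₂‖ +
      (2 * (L * ℓ + L + ‖B‖ * ℓ) + c * ℓ) * (dist p₁ p₂ + dist q₁ q₂) := by
  set D := x - x₂ with hD
  set e := B (x₁ - x) - (f x₁ p₁ q₁ - f x p₂ q₂) with he
  set err := f x p₂ q₂ - f x₂ p₂ q₂ - A D with herr
  have hp0 : 0 ≤ dist p₁ p₂ := dist_nonneg
  have hq0 : 0 ≤ dist q₁ q₂ := dist_nonneg
  have hen : ‖e‖ ≤ (L * ℓ + L + ‖B‖ * ℓ) * (dist p₁ p₂ + dist q₁ q₂) := by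
    rw [norm_sub_rev x₁ x] at hLip
    have h1 : ‖B (x₁ - x)‖ ≤ ‖B‖ * (ℓ * dist p₁ p₂) := by
      refine (B.le_opNorm _).trans ?_
      rw [norm_sub_rev]
      gcongr
    have h2 : ‖f x₁ p₁ q₁ - f x p₂ q₂‖ ≤ L * (ℓ * dist p₁ p₂ + dist p₁ p₂ + dist q₁ q₂) :=
      hLip.trans (by gcongr)
    have h3 : 0 ≤ (L * ℓ + ‖B‖ * ℓ) * dist q₁ q₂ := by positivity
    calc ‖e‖ ≤ ‖B (x₁ - x)‖ + ‖f x₁ p₁ q₁ - f x p₂ q₂‖ := norm_sub_le _ _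
      _ ≤ _ := by linarith
  have hmono := hq.le_inner hin 0 hx hx₂
  have hvec : v₁ - f x₁ p₁ q₁ + B x₁ - B x + B x + (0 : ℝ) • x -
      (v₂ - f x₂ p₂ q₂ + B x₂ + (0 : ℝ) • x₂) = (v₁ - v₂ + e) + (B D - A D) - err := by
    simp only [he, herr, hD, map_sub, zero_smul]
    abel
  rw [hvec, ← hD, inner_sub_left, inner_add_left, inner_sub_left (B D), hAB, sub_self,
    add_zero] at hmono
  have herr1 : -(c / 4 * ‖D‖ ^ 2) ≤ ⟪err, D⟫ := by
    have h1 := (abs_le.1 (abs_real_inner_le_norm err D)).1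
    have h2 : ‖err‖ * ‖D‖ ≤ c / 4 * ‖D‖ * ‖D‖ := by gcongr
    linarith
  have hkey : ‖(v₁ - v₂ + e) - c • D‖ ≤ ‖v₁ - v₂ + e‖ := by
    refine abs_le_of_sq_le_sq' ?_ (norm_nonneg _) |>.2
    rw [norm_sub_sq_real, real_inner_smul_right, norm_smul, Real.norm_eq_abs, mul_pow, sq_abs]
    have h1 : 0 ≤ c ^ 2 * ‖D‖ ^ 2 := by positivity
    have h2 : c * (c / 2 * ‖D‖ ^ 2) ≤ c * ⟪v₁ - v₂ + e, D⟫ := by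
      refine mul_le_mul_of_nonneg_left ?_ hc.le
      have := mul_nonneg hc.le (sq_nonneg ‖D‖)
      linarith
    linarith
  have hsplit : (v₁ - v₂) - (2 * (c / 2)) • (x₁ - x₂) =
      ((v₁ - v₂ + e) - c • D) - e + c • (x - x₁) := by
    rw [hD, mul_div_cancel₀ c two_ne_zero]
    simp only [smul_sub]
    abel
  have hcx : ‖c • (x - x₁)‖ ≤ c * ℓ * (dist p₁ p₂ + dist q₁ q₂) := by
    rw [norm_smul, Real.norm_eq_abs, abs_of_pos hc]
    have h3 : 0 ≤ c * ℓ * dist q₁ q₂ := by positivity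
    have := mul_le_mul_of_nonneg_left hxx hc.le
    linarith
  rw [hsplit]
  have h1 := norm_add_le ((v₁ - v₂ + e) - c • D - e) (c • (x - x₁))
  have h2 := norm_sub_le ((v₁ - v₂ + e) - c • D) e
  have h3 := norm_add_le (v₁ - v₂) e
  linarith

/-- Sufficiency of the pointbased coderivative conditions for full stability. -/
lemma lipFullStable_of_coderivative [FiniteDimensional ℝ X] [FiniteDimensional ℝ W]
    {f : X → W → Q → X} {Df : X → W → Q → X →L[ℝ] X} {g : X → W → EReal}
    {xb vb vh : X} {pb : W} {qb : Q}
    (hlsc : LowerSemicontinuous fun t : X × W => g t.1 t.2) (hproper : ∀ x p, g x p ≠ ⊥)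
    (hvh : vh = vb - f xb pb qb) (hmem : vh ∈ pSubdiff g xb pb)
    (hA1 : A1 f xb pb qb) (hA2 : A2 g xb pb vh) (hA3 : A3 g xb pb) (hA4 : A4 f Df xb pb qb)
    (ha : ∀ z : W, (0, z) ∈ limCoderivFull g xb pb vh 0 → z = 0)
    (hb : ∀ w : X, w ≠ 0 → ∀ zs ∈ limCoderivFull g xb pb vh w,
      0 < ⟪Df xb pb qb w, w⟫ + ⟪zs.1, w⟫) :
    LipFullStable (SolMap f g) xb vb pb qb := by
  set A := Df xb pb qb with hA
  set B : X →L[ℝ] X := (1 / 2 : ℝ) • (A + ContinuousLinearMap.adjoint A) with hBdef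
  have hB : ∀ a b, ⟪B a, b⟫ = ⟪a, B b⟫ := by
    intro a b
    simp only [hBdef, smul_apply, add_apply, real_inner_smul_left, real_inner_smul_right,
      inner_add_left, inner_add_right, ContinuousLinearMap.adjoint_inner_left,
      ContinuousLinearMap.adjoint_inner_right]
    ring
  have hAB : ∀ w, ⟪B w, w⟫ = ⟪A w, w⟫ := by
    intro w
    simp only [hBdef, smul_apply, add_apply, real_inner_smul_left,
      inner_add_left, ContinuousLinearMap.adjoint_inner_left]
    rw [real_inner_comm (A w) w]
    ring
  obtain ⟨c, hc, ε₁, hε₁, hq₁⟩ := exists_quadMinorant_neg hlsc hproper hB hAB hmem hA2 hA3 ha hb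
  obtain ⟨ε₂, hε₂, hin₂⟩ := exists_innerReg hproper hmem hA2 hA3
  obtain ⟨ℓ, hℓ, ε₃, hε₃, hN⟩ := exists_normal_bound hAB ha hb 0
  obtain ⟨ρ₀, hρ₀, hstrict⟩ := hA4.strict_approx (e := c / 4) (by positivity)
  obtain ⟨L, hL, ε₄, hε₄, hLip⟩ := id hA1
  set ε := min (min ε₁ ε₂) (min ε₃ (min ρ₀ ε₄)) with hε
  have hε0 : 0 < ε := by positivity
  have hle₁ : ε ≤ ε₁ := (min_le_left _ _).trans (min_le_left _ _)
  have hle₂ : ε ≤ ε₂ := (min_le_left _ _).trans (min_le_right _ _)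
  have hle₃ : ε ≤ ε₃ := (min_le_right _ _).trans (min_le_left _ _)
  have hleρ : ε ≤ ρ₀ := (min_le_right _ _).trans ((min_le_right _ _).trans (min_le_left _ _))
  have hle₄ : ε ≤ ε₄ := (min_le_right _ _).trans ((min_le_right _ _).trans (min_le_right _ _))
  have hq := hq₁.mono le_rfl hle₁
  have hin := hin₂.mono hle₂
  obtain ⟨η, hη, Θ, -, hΘ, hΘlip⟩ := exists_lipschitz_resolvent (T := 0) hlsc hproper hB hmem hq
    hin (by linarith) le_rfl hε0 hℓ.le fun x p v hn => hN 0 ⟨le_rfl, le_rfl⟩ x p v (hn.mono hle₃)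
  set yb := vh + B xb + (0 : ℝ) • xb with hyb
  have hev : ∀ᶠ s : X × X × W × Q in 𝓝 (xb, vb, pb, qb),
      ‖s.2.1 - f s.1 s.2.2.1 s.2.2.2 - vh‖ < ε ∧
      ‖s.2.1 - f s.1 s.2.2.1 s.2.2.2 + B s.1 - yb‖ < η := by
    have hfc : ContinuousAt (fun s : X × X × W × Q => f s.1 s.2.2.1 s.2.2.2) (xb, vb, pb, qb) :=
      ContinuousAt.comp (f := fun s : X × X × W × Q => (s.1, s.2.2.1, s.2.2.2))
        (g := fun t : X × W × Q => f t.1 t.2.1 t.2.2) hA1.continuousAt (by fun_prop)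
    have h1 : ContinuousAt (fun s : X × X × W × Q => s.2.1) (xb, vb, pb, qb) := by fun_prop
    have c1 := ((h1.sub hfc).sub (continuousAt_const (y := vh))).norm
    have h2 : ContinuousAt (fun s : X × X × W × Q => B s.1) (xb, vb, pb, qb) := by fun_prop
    have c2 := (((h1.sub hfc).add h2).sub (continuousAt_const (y := yb))).norm
    refine (c1.eventually (gt_mem_nhds ?_)).and (c2.eventually (gt_mem_nhds ?_))
    · simpa [hvh] using hε0
    · simpa [hyb, hvh] using hη
  obtain ⟨δ, hδ, hball⟩ := Metric.eventually_nhds_iff.1 hev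
  set r := min (min δ ε) η with hr
  have hr0 : 0 < r := by positivity
  have hrδ : r ≤ δ := (min_le_left _ _).trans (min_le_left _ _)
  have hrε : r ≤ ε := (min_le_left _ _).trans (min_le_right _ _)
  have hrη : r ≤ η := min_le_right _ _
  obtain ⟨ν, hν, hsol⟩ := exists_local_solution hlsc hproper hB hAB hmem hvh hc hε0 hq hin hA1 hρ₀
    hstrict (half_pos hr0)
  set ν' := min ν r with hν'
  have hν'0 : 0 < ν' := by positivity
  have hνr : ν' ≤ r := min_le_right _ _
  have hnear : ∀ v ∈ ball vb ν', ∀ p ∈ ball pb ν', ∀ q ∈ ball qb ν', ∀ x ∈ closedBall xb (r / 2),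
      x ∈ SolMap f g v p q → NearGph g xb pb vh ε x p (v - f x p q) ∧
        ‖v - f x p q + B x - yb‖ < η := by
    intro v hv p hp q hq' x hx hxs
    rw [mem_ball] at hv hp hq'
    rw [mem_closedBall] at hx
    obtain ⟨h1, h2⟩ := @hball (x, v, p, q) (by
      rw [Prod.dist_eq, Prod.dist_eq, Prod.dist_eq, max_lt_iff, max_lt_iff, max_lt_iff]
      refine ⟨?_, ?_, ?_, ?_⟩ <;> simp only <;> linarith)
    refine ⟨⟨hxs, ?_, by linarith, h1⟩, h2⟩
    rw [← dist_eq_norm]; linarith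
  have hest : ∀ v₁ ∈ ball vb ν', ∀ p₁ ∈ ball pb ν', ∀ q₁ ∈ ball qb ν',
      ∀ v₂ ∈ ball vb ν', ∀ p₂ ∈ ball pb ν', ∀ q₂ ∈ ball qb ν', ∀ x₁ ∈ closedBall xb (r / 2),
      ∀ x₂ ∈ closedBall xb (r / 2), x₁ ∈ SolMap f g v₁ p₁ q₁ → x₂ ∈ SolMap f g v₂ p₂ q₂ →
      ‖(v₁ - v₂) - (2 * (c / 2)) • (x₁ - x₂)‖ ≤ ‖v₁ - v₂‖ +
        (2 * (L * (ℓ + 2) + L + ‖B‖ * (ℓ + 2)) + c * (ℓ + 2)) * (dist p₁ p₂ + dist q₁ q₂) := by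
    intro v₁ hv₁ p₁ hp₁ q₁ hq₁ v₂ hv₂ p₂ hp₂ q₂ hq₂ x₁ hx₁ x₂ hx₂ hs₁ hs₂
    obtain ⟨n₁, y₁⟩ := hnear v₁ hv₁ p₁ hp₁ q₁ hq₁ x₁ hx₁ hs₁
    obtain ⟨n₂, -⟩ := hnear v₂ hv₂ p₂ hp₂ q₂ hq₂ x₂ hx₂ hs₂
    have hm : ∀ p ∈ ball pb ν', (p, v₁ - f x₁ p₁ q₁ + B x₁) ∈ ball (pb, yb) η := by
      intro p hp
      rw [mem_ball, Prod.dist_eq, max_lt_iff, dist_eq_norm (v₁ - f x₁ p₁ q₁ + B x₁)]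
      exact ⟨lt_of_lt_of_le hp (hνr.trans hrη), y₁⟩
    have hΘ₁ : Θ (p₁, v₁ - f x₁ p₁ q₁ + B x₁) = x₁ := by
      refine hq.eq_of_eq hin (T := 0) (by linarith) (hΘ _ (hm p₁ hp₁)) n₁ ?_
      simp only [zero_smul]
      abel
    have nx := hΘ _ (hm p₂ hp₂)
    simp only [zero_smul, sub_zero] at nx
    have hxx := hΘlip _ (hm p₂ hp₂) _ (hm p₁ hp₁)
    rw [hΘ₁] at hxx
    simp only [sub_self, norm_zero, add_zero] at hxx
    rw [← dist_eq_norm p₂ p₁, dist_comm p₂ p₁] at hxx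
    have dp : ∀ p ∈ ball pb ν', dist p pb < ε := fun p hp =>
      lt_of_lt_of_le hp (hνr.trans hrε)
    have dq : ∀ q ∈ ball qb ν', dist q qb < ε := fun q hq =>
      lt_of_lt_of_le hq (hνr.trans hrε)
    refine hq.stability_estimate hAB hc (by positivity) hL.le hin nx n₂ hxx ?_ ?_
    · exact hLip _ _ _ _ _ _ (n₁.2.1.trans_le hle₄) (nx.2.1.trans_le hle₄)
        ((dp _ hp₁).trans_le hle₄) ((dp _ hp₂).trans_le hle₄) ((dq _ hq₁).trans_le hle₄)
        ((dq _ hq₂).trans_le hle₄)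
    · exact hstrict _ _ _ _ (nx.2.1.trans_le hleρ) (n₂.2.1.trans_le hleρ)
        ((dp _ hp₂).trans_le hleρ) ((dq _ hq₂).trans_le hleρ)
  have hex : ∀ v p q, ∃ x, v ∈ ball vb ν' → p ∈ ball pb ν' → q ∈ ball qb ν' →
      x ∈ closedBall xb (r / 2) ∧ x ∈ SolMap f g v p q := by
    intro v p q
    by_cases h : v ∈ ball vb ν' ∧ p ∈ ball pb ν' ∧ q ∈ ball qb ν'
    · have hνν : ν' ≤ ν := min_le_left _ _
      obtain ⟨x, hx, hxs⟩ := hsol v p q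
        (by rw [← dist_eq_norm]; exact lt_of_lt_of_le h.1 hνν)
        (lt_of_lt_of_le h.2.1 hνν) (lt_of_lt_of_le h.2.2 hνν)
      exact ⟨x, fun _ _ _ => ⟨by rwa [mem_closedBall, dist_eq_norm], hxs⟩⟩
    · exact ⟨xb, fun h1 h2 h3 => absurd ⟨h1, h2, h3⟩ h⟩
  choose ϑ hϑ using hex
  refine ⟨_, ball_mem_nhds vb hν'0, _, ball_mem_nhds pb hν'0, _, ball_mem_nhds qb hν'0, _,
    closedBall_mem_nhds xb (half_pos hr0), ϑ, ?_, c / 2, by positivity,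
    2 * (L * (ℓ + 2) + L + ‖B‖ * (ℓ + 2)) + c * (ℓ + 2), by positivity, ?_⟩
  · intro v hv p hp q hq'
    obtain ⟨h1, h2⟩ := hϑ v p q hv hp hq'
    refine ⟨h1, h2, fun x hx hxs => ?_⟩
    have h3 := hest v hv p hp q hq' v hv p hp q hq' x hx _ h1 hxs h2
    rw [sub_self, zero_sub, norm_neg, norm_zero, dist_self, dist_self, add_zero, mul_zero,
      add_zero, norm_smul, Real.norm_eq_abs, abs_of_pos (by positivity)] at h3
    have h4 : ‖x - ϑ v p q‖ ≤ 0 := by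
      by_contra hcon
      push Not at hcon
      have : 0 < 2 * (c / 2) * ‖x - ϑ v p q‖ := by positivity
      linarith
    exact sub_eq_zero.1 (norm_le_zero_iff.1 h4)
  · intro v₁ hv₁ p₁ hp₁ q₁ hq₁ v₂ hv₂ p₂ hp₂ q₂ hq₂
    obtain ⟨h1, h2⟩ := hϑ v₁ p₁ q₁ hv₁ hp₁ hq₁
    obtain ⟨h3, h4⟩ := hϑ v₂ p₂ q₂ hv₂ hp₂ hq₂
    exact hest v₁ hv₁ p₁ hp₁ q₁ hq₁ v₂ hv₂ p₂ hp₂ q₂ hq₂ _ h1 _ h3 h2 h4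

/-- Under Lipschitzian full stability the solution map has, near every graph point close to the
reference one, a localization with the full stability estimate. -/
lemma LipFullStable.eventually_localization {E : Type*} [NormedAddCommGroup E]
    {f : X → E → Q → X} {g : X → E → EReal}
    {xb vb vh : X} {pb : E} {qb : Q} (h : LipFullStable (SolMap f g) xb vb pb qb)
    (hvh : vh = vb - f xb pb qb) (hA1 : A1 f xb pb qb) :
    ∃ κ > (0 : ℝ), ∃ ℓ > (0 : ℝ), ∃ ϑ : X → E → X, ∀ᶠ ω in 𝓝[subGraph g] (xb, pb, vh),
      Tendsto (fun t : X × E => ϑ t.1 t.2) (𝓝 (ω.2.2 + f ω.1 ω.2.1 qb, ω.2.1)) (𝓝 ω.1) ∧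
      ∀ᶠ t in 𝓝 (ω.2.2 + f ω.1 ω.2.1 qb, ω.2.1),
        (ϑ t.1 t.2, t.2, t.1 - f (ϑ t.1 t.2) t.2 qb) ∈ subGraph g ∧
        ‖(t.1 - (ω.2.2 + f ω.1 ω.2.1 qb)) - (2 * κ) • (ϑ t.1 t.2 - ω.1)‖
          ≤ ‖t.1 - (ω.2.2 + f ω.1 ω.2.1 qb)‖ + ℓ * ‖t.2 - ω.2.1‖ := by
  obtain ⟨V, hV, Pn, hPn, Qn, hQn, U, hU, ϑ, hloc, κ, hκ, ℓ, hℓ, hest⟩ := h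
  have hqb := mem_of_mem_nhds hQn
  refine ⟨κ, hκ, ℓ, hℓ, fun v p => ϑ v p qb, ?_⟩
  have hcont : ContinuousAt (fun ω : X × E × X => (ω.2.2 + f ω.1 ω.2.1 qb, ω.2.1))
      (xb, pb, vh) := by
    have h1 : ContinuousAt (fun ω : X × E × X => f ω.1 ω.2.1 qb) (xb, pb, vh) :=
      ContinuousAt.comp' (f := fun ω : X × E × X => (ω.1, ω.2.1, qb))
        (g := fun t : X × E × Q => f t.1 t.2.1 t.2.2) hA1.continuousAt (by fun_prop)
    have h2 : ContinuousAt (fun ω : X × E × X => ω.2.2) (xb, pb, vh) := by fun_prop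
    exact (h2.add h1).prodMk (by fun_prop)
  have hb : (vh + f xb pb qb, pb) = (vb, pb) := by rw [hvh, sub_add_cancel]
  have hnear : ∀ᶠ ω in 𝓝 (xb, pb, vh),
      ∀ᶠ t in 𝓝 (ω.2.2 + f ω.1 ω.2.1 qb, ω.2.1), t ∈ V ×ˢ Pn := by
    refine hcont.eventually (p := fun y => ∀ᶠ t in 𝓝 y, t ∈ V ×ˢ Pn) ?_
    simp only [hb]
    exact (eventually_mem_set.2 (prod_mem_nhds hV hPn)).eventually_nhds
  have hUev : ∀ᶠ ω : X × E × X in 𝓝 (xb, pb, vh), ω.1 ∈ U :=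
    continuousAt_fst.eventually_mem hU
  filter_upwards [hnear.filter_mono nhdsWithin_le_nhds, hUev.filter_mono nhdsWithin_le_nhds,
    self_mem_nhdsWithin] with ω hω hωU hωG
  obtain ⟨x, p, v⟩ := ω
  simp only at hω hωU ⊢
  obtain ⟨hvV, hpP⟩ := hω.self_of_nhds
  have hx : x = ϑ (v + f x p qb) p qb :=
    (hloc _ hvV _ hpP _ hqb).2.2 x hωU (by
      change v + f x p qb - f x p qb ∈ pSubdiff g x p
      rwa [add_sub_cancel_right])
  have hE : ∀ᶠ t in 𝓝 (v + f x p qb, p),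
      (ϑ t.1 t.2 qb, t.2, t.1 - f (ϑ t.1 t.2 qb) t.2 qb) ∈ subGraph g ∧
        ‖(t.1 - (v + f x p qb)) - (2 * κ) • (ϑ t.1 t.2 qb - x)‖
          ≤ ‖t.1 - (v + f x p qb)‖ + ℓ * ‖t.2 - p‖ := by
    filter_upwards [hω] with t ht
    refine ⟨(hloc _ ht.1 _ ht.2 _ hqb).2.1, ?_⟩
    have := hest _ ht.1 _ ht.2 _ hqb _ hvV _ hpP _ hqb
    rwa [← hx, dist_self, add_zero, dist_eq_norm t.2 p] at this
  refine ⟨?_, hE⟩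
  rw [tendsto_iff_norm_sub_tendsto_zero]
  have hc : Continuous fun t : X × E =>
      (2 * ‖t.1 - (v + f x p qb)‖ + ℓ * ‖t.2 - p‖) / (2 * κ) := by fun_prop
  have h0 := hc.tendsto (v + f x p qb, p)
  simp only [sub_self, norm_zero, mul_zero, add_zero, zero_div] at h0
  refine squeeze_zero' (Eventually.of_forall fun _ => norm_nonneg _) ?_ h0
  filter_upwards [hE] with t ht
  rw [le_div_iff₀ (by positivity)]
  have h1 := norm_sub_norm_le ((2 * κ) • (ϑ t.1 t.2 qb - x)) (t.1 - (v + f x p qb))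
  rw [norm_sub_rev ((2 * κ) • _), norm_smul, Real.norm_eq_abs,
    abs_of_pos (by positivity : 0 < 2 * κ)] at h1
  linarith [ht.2]

/-- Regular normals to the graph near the reference point inherit estimates from Lipschitzian
full stability. -/
lemma LipFullStable.eventually_regNC3_estimate [CompleteSpace X]
    {f : X → W → Q → X} {Df : X → W → Q → X →L[ℝ] X}
    {g : X → W → EReal} {xb vb vh : X} {pb : W} {qb : Q}
    (h : LipFullStable (SolMap f g) xb vb pb qb) (hvh : vh = vb - f xb pb qb)
    (hA1 : A1 f xb pb qb) (hA4 : A4 f Df xb pb qb) :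
    ∃ κ > (0 : ℝ), ∃ C > (0 : ℝ), ∀ e > (0 : ℝ), ∀ᶠ ω in 𝓝[subGraph g] (xb, pb, vh),
      ∀ z s w, (z, s, -w) ∈ regNC3 (subGraph g) ω →
        ‖s‖ ≤ C * (‖z‖ + ‖w‖) ∧
        ‖z + ContinuousLinearMap.adjoint (Df xb pb qb) w - (2 * κ) • w‖
          ≤ ‖z + ContinuousLinearMap.adjoint (Df xb pb qb) w‖ + 2 * e * ‖w‖ := by
  obtain ⟨κ, hκ, ℓ, hℓ, ϑ, hϑ⟩ := h.eventually_localization hvh hA1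
  obtain ⟨L, hL, ε₁, hε₁, hLip⟩ := id hA1
  refine ⟨κ, hκ, ℓ / (2 * κ) + L * (ℓ / (2 * κ) + 1), by positivity, fun e he => ?_⟩
  obtain ⟨ρ, hρ, hstrict⟩ := hA4.strict_approx he
  set A := Df xb pb qb
  set r := min ρ ε₁ with hr
  have hr0 : 0 < r := lt_min hρ hε₁
  have hball : ∀ᶠ ω : X × W × X in 𝓝[subGraph g] (xb, pb, vh),
      ω.1 ∈ ball xb r ∧ ω.2.1 ∈ ball pb r := by
    refine Eventually.filter_mono nhdsWithin_le_nhds ?_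
    have h1 : ContinuousAt (fun ω : X × W × X => ω.2.1) (xb, pb, vh) := by fun_prop
    exact (continuousAt_fst.eventually_mem (ball_mem_nhds _ hr0)).and
      (h1.eventually_mem (ball_mem_nhds _ hr0))
  filter_upwards [hϑ, hball] with ω ⟨hlim, hev⟩ ⟨hxr, hpr⟩ z s w hζ
  rw [mem_regNC3_iff] at hζ
  obtain ⟨x, p, v⟩ := ω
  simp only at hlim hev hxr hpr hζ
  have hxp : ContinuousAt (fun t : X × W => f t.1 t.2 qb) (x, p) := by
    rw [ContinuousAt, tendsto_iff_norm_sub_tendsto_zero]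
    have hc : Continuous fun t : X × W => L * (‖t.1 - x‖ + dist t.2 p) := by fun_prop
    have h0 := hc.tendsto (x, p)
    simp only [sub_self, norm_zero, dist_self, add_zero, mul_zero] at h0
    refine squeeze_zero' (Eventually.of_forall fun _ => norm_nonneg _) ?_ h0
    filter_upwards [prod_mem_nhds (isOpen_ball.mem_nhds hxr) (isOpen_ball.mem_nhds hpr)] with t ht
    have := hLip t.1 x t.2 p qb qb
      (by rw [← dist_eq_norm]; exact lt_of_lt_of_le ht.1 (min_le_right _ _))
      (by rw [← dist_eq_norm]; exact lt_of_lt_of_le hxr (min_le_right _ _))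
      (lt_of_lt_of_le ht.2 (min_le_right _ _)) (lt_of_lt_of_le hpr (min_le_right _ _))
      (by simpa) (by simpa)
    simpa using this
  have hsnd : Tendsto (fun t : X × W => t.2) (𝓝 (v + f x p qb, p)) (𝓝 p) :=
    continuous_snd.tendsto _
  have hfst : Tendsto (fun t : X × W => t.1) (𝓝 (v + f x p qb, p)) (𝓝 (v + f x p qb)) :=
    continuous_fst.tendsto _
  have hpt : Tendsto (fun t : X × W => (ϑ t.1 t.2, t.2, t.1 - f (ϑ t.1 t.2) t.2 qb))
      (𝓝 (v + f x p qb, p)) (𝓝[subGraph g] (x, p, v)) := by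
    refine tendsto_nhdsWithin_iff.2 ⟨hlim.prodMk_nhds (hsnd.prodMk_nhds ?_),
      hev.mono fun t => And.left⟩
    have := hfst.sub (hxp.tendsto.comp (hlim.prodMk_nhds hsnd))
    rwa [add_sub_cancel_right] at this
  have key : ∀ ε > 0, ∀ᶠ t in 𝓝 (v + f x p qb, p), ∃ d : X, ∃ φ : X,
      ‖(t.1 - (v + f x p qb)) - (2 * κ) • d‖ ≤ ‖t.1 - (v + f x p qb)‖ + ℓ * ‖t.2 - p‖ ∧
      ‖φ‖ ≤ L * (‖d‖ + ‖t.2 - p‖) ∧ (t.2 = p → ‖φ - A d‖ ≤ e * ‖d‖) ∧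
      ⟪z, d⟫ + ⟪s, t.2 - p⟫ - ⟪w, t.1 - (v + f x p qb) - φ⟫
        ≤ ε * (‖d‖ + ‖t.2 - p‖ + ‖t.1 - (v + f x p qb) - φ‖) := by
    intro ε hε
    filter_upwards [hpt.eventually (hζ ε hε), hev, hlim.eventually (isOpen_ball.mem_nhds hxr),
      hsnd.eventually (isOpen_ball.mem_nhds hpr)] with t h1 h2 h3 h4
    refine ⟨ϑ t.1 t.2 - x, f (ϑ t.1 t.2) t.2 qb - f x p qb, h2.2, ?_, ?_, ?_⟩
    · have := hLip (ϑ t.1 t.2) x t.2 p qb qb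
        (by rw [← dist_eq_norm]; exact lt_of_lt_of_le h3 (min_le_right _ _))
        (by rw [← dist_eq_norm]; exact lt_of_lt_of_le hxr (min_le_right _ _))
        (lt_of_lt_of_le h4 (min_le_right _ _)) (lt_of_lt_of_le hpr (min_le_right _ _))
        (by simpa) (by simpa)
      simpa [dist_eq_norm] using this
    · intro hp
      rw [hp]
      rw [hp] at h3
      exact hstrict _ _ _ _
        (by rw [← dist_eq_norm]; exact lt_of_lt_of_le h3 (min_le_left _ _))
        (by rw [← dist_eq_norm]; exact lt_of_lt_of_le hxr (min_le_left _ _))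
        (lt_of_lt_of_le hpr (min_le_left _ _)) (by simpa)
    · have e1 : t.1 - f (ϑ t.1 t.2) t.2 qb - v
          = t.1 - (v + f x p qb) - (f (ϑ t.1 t.2) t.2 qb - f x p qb) := by abel
      simp only [e1, inner_neg_left] at h1
      linarith
  have dir : ∀ ε > (0 : ℝ), ∀ (h : X) (π : W), ∃ d φ : X,
      ‖h - (2 * κ) • d‖ ≤ ‖h‖ + ℓ * ‖π‖ ∧ ‖φ‖ ≤ L * (‖d‖ + ‖π‖) ∧
      (π = 0 → ‖φ - A d‖ ≤ e * ‖d‖) ∧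
      ⟪z, d⟫ + ⟪s, π⟫ - ⟪w, h - φ⟫ ≤ ε * (‖d‖ + ‖π‖ + ‖h - φ‖) := by
    intro ε hε h π
    have hcurve : Tendsto (fun τ : ℝ => (v + f x p qb + τ • h, p + τ • π)) (𝓝[>] 0)
        (𝓝 (v + f x p qb, p)) := by
      have hc : Continuous fun τ : ℝ => (v + f x p qb + τ • h, p + τ • π) := by fun_prop
      have h0 := hc.tendsto 0
      simp only [zero_smul, add_zero] at h0
      exact h0.mono_left nhdsWithin_le_nhds
    obtain ⟨τ, ⟨d, φ, h1, h2, h3, h4⟩, hτ⟩ :=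
      ((hcurve.eventually (key ε hε)).and self_mem_nhdsWithin).exists
    have hτ : 0 < τ := hτ
    obtain ⟨d, rfl⟩ : ∃ d', d = τ • d' := ⟨τ⁻¹ • d, (smul_inv_smul₀ hτ.ne' d).symm⟩
    obtain ⟨φ, rfl⟩ : ∃ φ', φ = τ • φ' := ⟨τ⁻¹ • φ, (smul_inv_smul₀ hτ.ne' φ).symm⟩
    simp only [add_sub_cancel_left, smul_comm (2 * κ) τ, ← smul_sub, map_smul, norm_smul,
      real_inner_smul_right, Real.norm_eq_abs, abs_of_pos hτ] at h1 h2 h3 h4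
    refine ⟨d, φ, ?_, ?_, fun hπ => ?_, ?_⟩ <;> refine le_of_mul_le_mul_left ?_ hτ
    · linarith
    · linarith
    · linarith [h3 (by rw [hπ, smul_zero, add_zero])]
    · linarith
  constructor
  · refine le_of_forall_pos_le_add fun δ hδ => ?_
    set k := ℓ / (2 * κ) with hk
    have hk0 : 0 < k := by positivity
    obtain ⟨d, φ, h1, h2, -, h4⟩ := dir (δ / (k + 1 + L * (k + 1))) (by positivity) 0 s
    rcases (norm_nonneg s).eq_or_lt with hs | hs
    · rw [← hs]; positivity
    rw [zero_sub, norm_neg, norm_smul, norm_zero, zero_add, Real.norm_eq_abs,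
      abs_of_pos (by positivity : 0 < 2 * κ)] at h1
    have hd : ‖d‖ ≤ k * ‖s‖ := by
      rw [hk, div_mul_eq_mul_div, le_div_iff₀ (by positivity)]
      linarith
    have hφ : ‖φ‖ ≤ L * (k + 1) * ‖s‖ := by
      calc ‖φ‖ ≤ L * (‖d‖ + ‖s‖) := h2
        _ ≤ L * (k * ‖s‖ + ‖s‖) := by gcongr
        _ = _ := by ring
    rw [zero_sub, norm_neg, inner_neg_right, real_inner_self_eq_norm_sq] at h4
    have e1 := neg_le_of_abs_le (abs_real_inner_le_norm z d)
    have e2 := neg_le_of_abs_le (abs_real_inner_le_norm w φ)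
    have e3 : ‖z‖ * ‖d‖ ≤ ‖z‖ * (k * ‖s‖) := by gcongr
    have e4 : ‖w‖ * ‖φ‖ ≤ ‖w‖ * (L * (k + 1) * ‖s‖) := by gcongr
    have e5 : δ / (k + 1 + L * (k + 1)) * (‖d‖ + ‖s‖ + ‖φ‖) ≤ δ * ‖s‖ := by
      calc _ ≤ δ / (k + 1 + L * (k + 1)) * (k * ‖s‖ + ‖s‖ + L * (k + 1) * ‖s‖) := by gcongr
        _ = _ := by field_simp
    refine le_of_mul_le_mul_right ?_ hs
    have e6 : 0 ≤ L * (k + 1) * ‖z‖ * ‖s‖ := by positivity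
    have e7 : 0 ≤ k * ‖w‖ * ‖s‖ := by positivity
    linarith
  · refine le_of_forall_pos_le_add fun δ hδ => ?_
    set y := z + ContinuousLinearMap.adjoint A w with hy
    set u := y - (2 * κ) • w with hu
    set M := 1 / κ + (1 + L * (1 / κ)) with hM
    have hM0 : 0 < M := by rw [hM]; positivity
    obtain ⟨d, φ, h1, h2, h3, h4⟩ := dir (δ / (2 * κ * M)) (by positivity) u 0
    rcases (norm_nonneg u).eq_or_lt with hs | hs
    · rw [← hs]; positivity
    simp only [norm_zero, mul_zero, add_zero, inner_zero_right, forall_true_left] at h1 h2 h3 h4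
    have hd : ‖d‖ ≤ 1 / κ * ‖u‖ := by
      have := norm_sub_norm_le ((2 * κ) • d) u
      rw [norm_sub_rev ((2 * κ) • _), norm_smul, Real.norm_eq_abs,
        abs_of_pos (by positivity : 0 < 2 * κ)] at this
      rw [one_div_mul_eq_div, le_div_iff₀ hκ]
      linarith
    have hφ : ‖u - φ‖ ≤ (1 + L * (1 / κ)) * ‖u‖ := by
      calc ‖u - φ‖ ≤ ‖u‖ + ‖φ‖ := norm_sub_le _ _
        _ ≤ ‖u‖ + L * ‖d‖ := by gcongr
        _ ≤ ‖u‖ + L * (1 / κ * ‖u‖) := by gcongr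
        _ = _ := by ring
    have hyd : ⟪y, d⟫ = ⟪z, d⟫ + ⟪w, A d⟫ := by
      rw [hy, inner_add_left, ContinuousLinearMap.adjoint_inner_left]
    have e1 := le_of_abs_le (abs_real_inner_le_norm y (u - (2 * κ) • d))
    have e2 := neg_le_of_abs_le (abs_real_inner_le_norm w (φ - A d))
    have e3 : ‖w‖ * ‖φ - A d‖ ≤ ‖w‖ * (e * (1 / κ * ‖u‖)) := by
      gcongr
      exact h3.trans (by gcongr)
    have e4 : ‖y‖ * ‖u - (2 * κ) • d‖ ≤ ‖y‖ * ‖u‖ := by gcongr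
    have e5 : 2 * κ * (δ / (2 * κ * M) * (‖d‖ + ‖u - φ‖)) ≤ δ * ‖u‖ := by
      calc _ ≤ 2 * κ * (δ / (2 * κ * M) * (1 / κ * ‖u‖ + (1 + L * (1 / κ)) * ‖u‖)) := by gcongr
        _ = 2 * κ * (δ / (2 * κ * M) * (M * ‖u‖)) := by rw [hM]; ring
        _ = _ := by field_simp [hM0.ne']
    have e6 : ‖u‖ * ‖u‖ = ⟪y, u⟫ - 2 * κ * ⟪w, u⟫ := by
      rw [← real_inner_self_eq_norm_mul_norm]
      nth_rw 1 [hu]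
      rw [inner_sub_left, real_inner_smul_left]
    have e7 : 2 * κ * (‖w‖ * (e * (1 / κ * ‖u‖))) = 2 * e * ‖w‖ * ‖u‖ := by field_simp
    simp only [inner_sub_right, real_inner_smul_right] at e1 e2 h4
    have e8 : 2 * κ * (⟪y, d⟫ - ⟪w, u⟫) ≤
        2 * κ * (δ / (2 * κ * M) * (‖d‖ + ‖u - φ‖)) + 2 * κ * (‖w‖ * (e * (1 / κ * ‖u‖))) := by
      rw [← mul_add]
      gcongr
      linarith
    refine le_of_mul_le_mul_right ?_ hs
    linarith

/-- Necessity of the pointbased coderivative conditions for Lipschitzian full stability. -/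
lemma LipFullStable.coderivative_conditions [CompleteSpace X]
    {f : X → W → Q → X} {Df : X → W → Q → X →L[ℝ] X}
    {g : X → W → EReal} {xb vb vh : X} {pb : W} {qb : Q}
    (h : LipFullStable (SolMap f g) xb vb pb qb) (hvh : vh = vb - f xb pb qb)
    (hA1 : A1 f xb pb qb) (hA4 : A4 f Df xb pb qb) :
    (∀ z : W, (0, z) ∈ limCoderivFull g xb pb vh 0 → z = 0) ∧
      ∀ w : X, w ≠ 0 → ∀ zs ∈ limCoderivFull g xb pb vh w,
        0 < ⟪Df xb pb qb w, w⟫ + ⟪zs.1, w⟫ := by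
  obtain ⟨κ, hκ, C, hC, hest⟩ := h.eventually_regNC3_estimate hvh hA1 hA4
  set A := Df xb pb qb
  have lim : ∀ z s w, (z, s) ∈ limCoderivFull g xb pb vh w →
      ‖s‖ ≤ C * (‖z‖ + ‖w‖) ∧ ‖z + ContinuousLinearMap.adjoint A w - (2 * κ) • w‖
          ≤ ‖z + ContinuousLinearMap.adjoint A w‖ := by
    rintro z s w ⟨ωs, ζs, hω, hωlim, hζ, hζlim⟩
    have hωG : Tendsto ωs atTop (𝓝[subGraph g] (xb, pb, vh)) :=
      tendsto_nhdsWithin_iff.2 ⟨hωlim, Eventually.of_forall hω⟩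
    have hev : ∀ e > (0 : ℝ), ∀ᶠ k in atTop, ‖(ζs k).2.1‖ ≤ C * (‖(ζs k).1‖ + ‖-(ζs k).2.2‖) ∧
        ‖(ζs k).1 + ContinuousLinearMap.adjoint A (-(ζs k).2.2) - (2 * κ) • -(ζs k).2.2‖
          ≤ ‖(ζs k).1 + ContinuousLinearMap.adjoint A (-(ζs k).2.2)‖
            + 2 * e * ‖-(ζs k).2.2‖ := by
      intro e he
      filter_upwards [hωG.eventually (hest e he)] with k hk
      refine hk _ _ _ ?_
      rw [neg_neg]
      exact hζ k
    have hz : Tendsto (fun k => (ζs k).1) atTop (𝓝 z) := (continuous_fst.tendsto _).comp hζlim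
    have hs : Tendsto (fun k => (ζs k).2.1) atTop (𝓝 s) :=
      (continuous_snd.fst.tendsto _).comp hζlim
    have hw : Tendsto (fun k => -(ζs k).2.2) atTop (𝓝 w) := by
      simpa using ((continuous_snd.snd.tendsto _).comp hζlim).neg
    have hAw := ((ContinuousLinearMap.adjoint A).continuous.tendsto w).comp hw
    refine ⟨le_of_tendsto_of_tendsto hs.norm ((hz.norm.add hw.norm).const_mul C)
      ((hev 1 one_pos).mono fun _ => And.left), ?_⟩
    have hbound : ∀ e > (0 : ℝ), ‖z + ContinuousLinearMap.adjoint A w - (2 * κ) • w‖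
        ≤ ‖z + ContinuousLinearMap.adjoint A w‖ + 2 * e * ‖w‖ := fun e he =>
      le_of_tendsto_of_tendsto ((hz.add hAw).sub (hw.const_smul (2 * κ))).norm
        ((hz.add hAw).norm.add (hw.norm.const_mul (2 * e))) ((hev e he).mono fun _ => And.right)
    refine le_of_forall_pos_le_add fun δ hδ => ?_
    refine (hbound (δ / (2 * (‖w‖ + 1))) (by positivity)).trans ?_
    gcongr
    rw [← mul_div_assoc, div_mul_eq_mul_div, div_le_iff₀ (by positivity)]
    nlinarith [norm_nonneg w]
  refine ⟨fun z hz => ?_, fun w hw zs hzs => ?_⟩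
  · simpa using (lim 0 z 0 hz).1
  · have h1 := (lim zs.1 zs.2 w hzs).2
    set y := zs.1 + ContinuousLinearMap.adjoint A w with hy
    have h2 : ⟪A w, w⟫ + ⟪zs.1, w⟫ = ⟪y, w⟫ := by
      rw [hy, inner_add_left, ContinuousLinearMap.adjoint_inner_left, real_inner_comm, add_comm]
    have h3 := norm_sub_sq_real y ((2 * κ) • w)
    have h4 := pow_le_pow_left₀ (norm_nonneg _) h1 2
    rw [norm_smul, Real.norm_eq_abs, abs_of_pos (by positivity : 0 < 2 * κ), mul_pow,
      real_inner_smul_right] at h3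
    have h5 : 0 < κ * ‖w‖ ^ 2 := by have := norm_pos_iff.2 hw; positivity
    rw [h2]
    refine h5.trans_le (le_of_mul_le_mul_left ?_ (by positivity : 0 < 4 * κ))
    linarith

/-- pointbased characterization of Lipschitzian full stability of
general PVS in finite dimensions (Proposition 4.2). -/
theorem statement1 {n l : ℕ} {Q : Type*} [MetricSpace Q]
    (f : EuclideanSpace ℝ (Fin n) → EuclideanSpace ℝ (Fin l) → Q → EuclideanSpace ℝ (Fin n))
    (Df : EuclideanSpace ℝ (Fin n) → EuclideanSpace ℝ (Fin l) → Q →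
      EuclideanSpace ℝ (Fin n) →L[ℝ] EuclideanSpace ℝ (Fin n))
    (g : EuclideanSpace ℝ (Fin n) → EuclideanSpace ℝ (Fin l) → EReal)
    (xb vb vh : EuclideanSpace ℝ (Fin n)) (pb : EuclideanSpace ℝ (Fin l)) (qb : Q)
    (hg_lsc : LowerSemicontinuous
      fun t : EuclideanSpace ℝ (Fin n) × EuclideanSpace ℝ (Fin l) => g t.1 t.2)
    (hg_proper : ∀ x p, g x p ≠ ⊥)
    (hvh : vh = vb - f xb pb qb)
    (hsol : xb ∈ SolMap f g vb pb qb)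
    (hA1 : A1 f xb pb qb) (hA2 : A2 g xb pb vh) (hA3 : A3 g xb pb)
    (hA4 : A4 f Df xb pb qb) :
    LipFullStable (SolMap f g) xb vb pb qb ↔
      ((∀ z : EuclideanSpace ℝ (Fin l), (0, z) ∈ limCoderivFull g xb pb vh 0 → z = 0) ∧
        ∀ w : EuclideanSpace ℝ (Fin n), w ≠ 0 →
          ∀ zs ∈ limCoderivFull g xb pb vh w, 0 < ⟪Df xb pb qb w, w⟫ + ⟪zs.1, w⟫) := by
  constructor
  · exact fun h => h.coderivative_conditions hvh hA1 hA4
  · rintro ⟨ha, hb⟩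
    exact lipFullStable_of_coderivative hg_lsc hg_proper hvh (by rw [hvh]; exact hsol)
      hA1 hA2 hA3 hA4 ha hb

end PVS
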